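/- Congestion bound for the Twiggy canonical path ensemble: Assume the model and Bayesian CART prior with p_{lk} = n^{-c}, c > 5/2 + log D, and Assumption 1(b) with |𝒯*_int| ≤ C₀ log²n and sufficiently large A. Then for every δ > 0 there exists N such that for all n ≥ N, with probability at least 1 − 4/n over ε ~ N(0, I_n), the congestion parameter of the Twiggy canonical path ensemble for the Twiggy Bayesian CART chain (with parameter D > 1) satisfies ρ(𝓔) ≤ ((D^L − 1)/(D − 1)) · 2^{L+1} · (1 + δ). -/

import Mathlib

open Finset MeasureTheory Real
open scoped BigOperators NNReal ENNReal

noncomputable section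

namespace BayesCART

/-! ## Trees

Nodes of the dyadic (Haar wavelet) tree are encoded by the index `j = 2^l + k`
(the root `ψ_{-1,0}` is `j = 0`, and `ψ_{l,k} ↦ 2^l + k` for `l ≥ 0`, `0 ≤ k < 2^l`).
The children of a node `j ≥ 1` are `2j` and `2j+1`, the unique child of the root `0`
is `1`, and the parent of `j ≥ 1` is `j / 2`.  A tree is identified with the finite
set `S` of its internal nodes, which must contain the root and be ancestor-closed. -/

/-- `S` is the internal-node set of a tree all of whose internal nodes have depth `< L`. -/
def IsTree (L : ℕ) (S : Finset ℕ) : Prop :=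
  0 ∈ S ∧ (∀ j ∈ S, 1 ≤ j → j / 2 ∈ S) ∧ ∀ j ∈ S, j < 2 ^ L

instance (L : ℕ) : DecidablePred (IsTree L) := fun _ => by unfold IsTree; infer_instance

/-- The (finite) collection `𝕋_L` of all trees with internal nodes of depth `< L`. -/
def trees (L : ℕ) : Finset (Finset ℕ) :=
  (Finset.range (2 ^ L)).powerset.filter (IsTree L)

/-- The external (leaf) nodes `𝒯_ext` of the tree with internal nodes `S`. -/
def extSet (S : Finset ℕ) : Finset ℕ :=
  ((S.image fun j => 2 * j) ∪ S.image fun j => 2 * j + 1).filter fun j => j ∉ S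

/-! ## The Haar design -/

/-- The Haar mother wavelet `ψ = 1_{(0,1/2]} − 1_{(1/2,1]}`. -/
def haarMother (x : ℝ) : ℝ :=
  if 0 < x ∧ x ≤ 1 / 2 then 1 else if 1 / 2 < x ∧ x ≤ 1 then -1 else 0

/-- Entry `i` of column `j` of the Haar design matrix with `n` observations at the
design points `x_i = (i+1)/n`: column `j = 0` is `ψ_{-1,0} ≡ 1`, and column
`j = 2^l + k ≥ 1` is `ψ_{lk}(x) = 2^{l/2} ψ(2^l x − k)`. -/
def haarCol (n j i : ℕ) : ℝ :=
  if j = 0 then 1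
  else
    (2 : ℝ) ^ ((Nat.log 2 j : ℝ) / 2) *
      haarMother ((2 : ℝ) ^ (Nat.log 2 j) * ((i + 1 : ℝ) / n) - ((j - 2 ^ Nat.log 2 j : ℕ) : ℝ))

/-- The inner product `X_j' Y` of the `j`-th design column with a vector `Y ∈ ℝⁿ`. -/
def colDot (n : ℕ) (Y : Fin n → ℝ) (j : ℕ) : ℝ := ∑ i : Fin n, haarCol n j i.val * Y i

/-- The vector `X β* = Σ_{j ∈ B} β*_j ψ_j` of values of `f₀` at the design points. -/
def signalVec (n : ℕ) (β : ℕ → ℝ) (B : Finset ℕ) : Fin n → ℝ :=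
  fun i => ∑ j ∈ B, β j * haarCol n j i.val

/-- The response `Y = X β* + ε`. -/
def Yvec (n : ℕ) (β : ℕ → ℝ) (B : Finset ℕ) (ε : Fin n → ℝ) : Fin n → ℝ :=
  fun i => signalVec n β B i + ε i

/-- The standard Gaussian measure of `ε = (ε_1, …, ε_n) ~ N(0, I_n)`. -/
def gauss (n : ℕ) : Measure (Fin n → ℝ) :=
  Measure.pi fun _ => ProbabilityTheory.gaussianReal 0 1

/-! ## Prior and posterior -/

/-- The split probability `p_{lk} = n^{-c}`. -/
def splitP (n : ℕ) (c : ℝ) : ℝ := (n : ℝ) ^ (-c)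

/-- Unnormalized Galton–Watson tree prior `Π(𝒯) ∝ ∏_{int} p ∏_{ext} (1 − p)`
with constant split probability `p`. -/
def priorWt (p : ℝ) (S : Finset ℕ) : ℝ := p ^ S.card * (1 - p) ^ (extSet S).card

/-- The marginal likelihood
`N_Y(𝒯) = (2π)^{-n/2} (1+n)^{-|𝒯_ext|/2} exp{−½ Y'[I − X_𝒯 Σ_𝒯 X_𝒯'] Y}`;
for the orthogonal Haar design (`X'X = nI`) with `Σ_𝒯 = (n/(n+1))(X_𝒯'X_𝒯)^{-1}`,
`Y' X_𝒯 Σ_𝒯 X_𝒯' Y = (n+1)^{-1} Σ_{j ∈ 𝒯_int} (X_j'Y)²`. -/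
def margLik (n : ℕ) (Y : Fin n → ℝ) (S : Finset ℕ) : ℝ :=
  (2 * π) ^ (-(n : ℝ) / 2) * ((1 + n : ℝ) ^ (-((extSet S).card : ℝ) / 2)) *
    Real.exp (-(1 / 2) * ((∑ i, Y i ^ 2) - (1 / ((n : ℝ) + 1)) * ∑ j ∈ S, colDot n Y j ^ 2))

/-- Unnormalized posterior weight `Π(𝒯) N_Y(𝒯)`. -/
def postWt (n : ℕ) (p : ℝ) (Y : Fin n → ℝ) (S : Finset ℕ) : ℝ :=
  priorWt p S * margLik n Y S

/-- Posterior probability `Π(𝒯 ∣ Y)` of a single tree in `𝕋_L`. -/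
def post (L n : ℕ) (p : ℝ) (Y : Fin n → ℝ) (S : Finset ℕ) : ℝ :=
  postWt n p Y S / ∑ T ∈ trees L, postWt n p Y T

/-- Posterior probability of a family of trees. -/
def postSet (L n : ℕ) (p : ℝ) (Y : Fin n → ℝ) (A : Finset (Finset ℕ)) : ℝ :=
  ∑ T ∈ A ∩ trees L, post L n p Y T

/-! ## Assumption 1 -/

/-- Assumption 1: `f₀ = Σ_{(l,k) ∈ ℬ} β*_{lk} ψ_{lk}` with all signal
coefficients of magnitude in `(A log n / √n, C)`, and `𝒯* ∈ 𝕋_L` is the smallest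
tree containing `ℬ` among its internal nodes. -/
structure Assumption1 (L n : ℕ) (A C : ℝ) (β : ℕ → ℝ) (B Sstar : Finset ℕ) : Prop where
  B_depth : ∀ j ∈ B, j < 2 ^ L
  signal_low : ∀ j ∈ B, A * Real.log n / Real.sqrt n < |β j|
  signal_high : ∀ j ∈ B, |β j| < C
  support : ∀ j, j ∉ B → β j = 0
  Sstar_tree : Sstar ∈ trees L
  Sstar_contains : B ⊆ Sstar
  Sstar_min : ∀ T ∈ trees L, B ⊆ T → Sstar ⊆ T

/-! ## The Bayesian CART proposal -/

/-- GROW candidates: external nodes of depth `< L`. -/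
def growCands (L : ℕ) (S : Finset ℕ) : Finset ℕ := (extSet S).filter fun j => j < 2 ^ L

/-- PRUNE candidates: pre-terminal internal nodes (no children internal), root excluded. -/
def pruneCands (S : Finset ℕ) : Finset ℕ :=
  S.filter fun j => j ≠ 0 ∧ 2 * j ∉ S ∧ 2 * j + 1 ∉ S

/-- The GROW/PRUNE proposal kernel of (dyadic) Bayesian CART: GROW and PRUNE are
chosen with probability `1/2` each (with forced moves at the null and the full tree),
a GROW splits a uniformly chosen external node, and a PRUNE collapses a uniformly
chosen pre-terminal node. -/
def bcartProp (L : ℕ) (S S' : Finset ℕ) : ℝ :=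
  (if (pruneCands S).Nonempty then (1 : ℝ) / 2 else 1) *
      (((growCands L S).filter fun j => insert j S = S').card / (growCands L S).card)
    + (if (growCands L S).Nonempty then (1 : ℝ) / 2 else 1) *
      (((pruneCands S).filter fun j => S.erase j = S').card / (pruneCands S).card)

/-! ## Metropolis–Hastings machinery -/

/-- The Metropolis–Hastings transition matrix on `𝕋_L` with target `π₀` and proposal `q`. -/
def mhTrans (L : ℕ) (π₀ : Finset ℕ → ℝ) (q : Finset ℕ → Finset ℕ → ℝ)
    (S S' : Finset ℕ) : ℝ :=
  if S' = S then
    1 - ∑ T ∈ (trees L).erase S, q S T * min 1 ((π₀ T * q T S) / (π₀ S * q S T))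
  else q S S' * min 1 ((π₀ S' * q S' S) / (π₀ S * q S S'))

/-- The lazy modification `(P + I)/2` of a transition matrix. -/
def lazy (P : Finset ℕ → Finset ℕ → ℝ) (S S' : Finset ℕ) : ℝ :=
  (1 / 2) * P S S' + if S' = S then 1 / 2 else 0

/-- `t`-step transition probabilities over the state space `𝕋_L`. -/
def iterP (L : ℕ) (P : Finset ℕ → Finset ℕ → ℝ) : ℕ → Finset ℕ → Finset ℕ → ℝ
  | 0, S, S' => if S' = S then 1 else 0
  | t + 1, S, S' => ∑ T ∈ trees L, iterP L P t S T * P T S'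

/-- Total variation distance `‖P^t(S, ·) − Π(· ∣ Y)‖_TV` between the chain at time `t`
started at `S` and the posterior. -/
def tvDist (L n : ℕ) (p : ℝ) (Y : Fin n → ℝ) (P : Finset ℕ → Finset ℕ → ℝ)
    (t : ℕ) (S : Finset ℕ) : ℝ :=
  (1 / 2) * ∑ T ∈ trees L, |iterP L P t S T - post L n p Y T|

/-- The `ε`-mixing time `τ_ε = max_{𝒯 ∈ 𝕋_L} min{t : Δ_𝒯(t') ≤ ε for all t' ≥ t}`. -/
def mixTime (L n : ℕ) (p : ℝ) (Y : Fin n → ℝ) (P : Finset ℕ → Finset ℕ → ℝ) (ε : ℝ) : ℕ :=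
  sInf {t | ∀ t' ≥ t, ∀ S ∈ trees L, tvDist L n p Y P t' S ≤ ε}

/-- The (non-lazy) Bayesian CART Metropolis–Hastings transition matrix. -/
def bcartP (L n : ℕ) (c : ℝ) (Y : Fin n → ℝ) : Finset ℕ → Finset ℕ → ℝ :=
  mhTrans L (post L n (splitP n c) Y) (bcartProp L)

end BayesCART
namespace BayesCART

/-! ## Twigs and the Twiggy proposal -/

/-- `isAnc a b`: node `a` is a strict ancestor of node `b`. -/
def isAnc (a b : ℕ) : Prop := ∃ t ∈ Finset.Icc 1 b, b / 2 ^ t = a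

instance (a b : ℕ) : Decidable (isAnc a b) := by unfold isAnc; infer_instance

/-- All nodes on the ancestral path from node `j` up to the root (including `j`). -/
def ancPath (j : ℕ) : Finset ℕ := (Finset.range (j + 1)).image fun t => j / 2 ^ t

/-- The tree obtained from `S` by growing, from the closest external node,
the twig ending at the node `j`: the smallest tree containing `S ∪ {j}`. -/
def growTwig (S : Finset ℕ) (j : ℕ) : Finset ℕ := S ∪ ancPath j

/-- The internal descendants of `j` inside the tree `S`. -/
def descIn (S : Finset ℕ) (j : ℕ) : Finset ℕ := S.filter fun m => isAnc j m

/-- Twiggy PRUNE candidates: non-root internal nodes whose internal descendants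
form a twig (a chain in the ancestry order). -/
def twigPruneCands (S : Finset ℕ) : Finset ℕ :=
  S.filter fun j => j ≠ 0 ∧
    ∀ a ∈ descIn S j, ∀ b ∈ descIn S j, a = b ∨ isAnc a b ∨ isAnc b a

/-- The tree obtained by the Twiggy PRUNE at `j`: remove `j` and all of its descendants. -/
def pruneTwig (S : Finset ℕ) (j : ℕ) : Finset ℕ := S \ insert j (descIn S j)

/-- Nodes of layer (depth) `l` missing from `S`. -/
def layerNodes (S : Finset ℕ) (l : ℕ) : Finset ℕ :=
  (Finset.Ico (2 ^ l) (2 ^ (l + 1))).filter fun j => j ∉ S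

/-- Probability `d_{l} = D^{-l} / Σ_{l' ∈ E} D^{-l'}` of picking layer `l` among the
eligible layers. -/
def layerWt (D : ℝ) (L : ℕ) (S : Finset ℕ) (l : ℕ) : ℝ :=
  D ^ (-(l : ℝ)) /
    ∑ l' ∈ (Finset.range L).filter (fun l' => (layerNodes S l').Nonempty), D ^ (-(l' : ℝ))

/-- The Twiggy Bayesian CART proposal kernel: GROW picks a layer with probability
`∝ D^{-l}` then a missing node uniformly within the layer and attaches the whole twig
to it; PRUNE removes a uniformly chosen twig. -/
def twiggyProp (L : ℕ) (D : ℝ) (S S' : Finset ℕ) : ℝ :=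
  (if (twigPruneCands S).Nonempty then (1 : ℝ) / 2 else 1) *
      ∑ l ∈ Finset.range L, layerWt D L S l *
        (((layerNodes S l).filter fun j => growTwig S j = S').card / (layerNodes S l).card)
    + (if ∃ l ∈ Finset.range L, (layerNodes S l).Nonempty then (1 : ℝ) / 2 else 1) *
      (((twigPruneCands S).filter fun j => pruneTwig S j = S').card / (twigPruneCands S).card)

/-- The (non-lazy) Twiggy Bayesian CART Metropolis–Hastings transition matrix. -/
def twiggyP (L n : ℕ) (c D : ℝ) (Y : Fin n → ℝ) : Finset ℕ → Finset ℕ → ℝ :=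
  mhTrans L (post L n (splitP n c) Y) (twiggyProp L D)

/-! ## Locally informed (LIT-MH) proposals -/

/-- GROW neighborhood `𝒩_g(𝒯)` of Bayesian CART: one extra internal node. -/
def bNg (L : ℕ) (S : Finset ℕ) : Finset (Finset ℕ) :=
  (growCands L S).image fun j => insert j S

/-- PRUNE neighborhood `𝒩_p(𝒯)` of Bayesian CART: one internal node removed. -/
def bNp (S : Finset ℕ) : Finset (Finset ℕ) := (pruneCands S).image fun j => S.erase j

/-- GROW neighborhood of Twiggy Bayesian CART: one extra twig. -/
def tNg (L : ℕ) (S : Finset ℕ) : Finset (Finset ℕ) :=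
  (((Finset.range (2 ^ L)).filter fun j => j ∉ S)).image fun j => growTwig S j

/-- PRUNE neighborhood of Twiggy Bayesian CART: one twig removed. -/
def tNp (S : Finset ℕ) : Finset (Finset ℕ) := (twigPruneCands S).image fun j => pruneTwig S j

/-- The posterior ratio `B(𝒯, 𝒯̃) = Π(𝒯̃|Y)/Π(𝒯|Y)`. -/
def postRatio (L n : ℕ) (c : ℝ) (Y : Fin n → ℝ) (S S' : Finset ℕ) : ℝ :=
  post L n (splitP n c) Y S' / post L n (splitP n c) Y S

/-- Informed GROW weight `w_g(𝒯̃|𝒯) = min{Π(𝒯̃|Y)/Π(𝒯|Y), n^{(A² log n)/8}}`. -/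
def wg (L n : ℕ) (c A : ℝ) (Y : Fin n → ℝ) (S S' : Finset ℕ) : ℝ :=
  min (postRatio L n c Y S S') ((n : ℝ) ^ ((A ^ 2 * Real.log n) / 8))

/-- Informed PRUNE weight `w_p(𝒯̃|𝒯) = max{1, min{Π(𝒯̃|Y)/Π(𝒯|Y), n^{c−3/2}}}`. -/
def wp (L n : ℕ) (c : ℝ) (Y : Fin n → ℝ) (S S' : Finset ℕ) : ℝ :=
  max 1 (min (postRatio L n c Y S S') ((n : ℝ) ^ (c - 3 / 2)))

/-- Normalizing constant `Z_g(𝒯)` of the informed GROW proposal. -/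
def Zg (L n : ℕ) (c A : ℝ) (Y : Fin n → ℝ) (Ng : Finset ℕ → Finset (Finset ℕ))
    (S : Finset ℕ) : ℝ := ∑ T ∈ Ng S, wg L n c A Y S T

/-- Normalizing constant `Z_p(𝒯)` of the informed PRUNE proposal. -/
def Zp (L n : ℕ) (c : ℝ) (Y : Fin n → ℝ) (Np : Finset ℕ → Finset (Finset ℕ))
    (S : Finset ℕ) : ℝ := ∑ T ∈ Np S, wp L n c Y S T

/-- The locally informed (LIT-MH) proposal with neighborhoods `Ng`, `Np`. -/
def infProp (L n : ℕ) (c A : ℝ) (Y : Fin n → ℝ)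
    (Ng Np : Finset ℕ → Finset (Finset ℕ)) (S S' : Finset ℕ) : ℝ :=
  (1 / 2) * (if S' ∈ Ng S then wg L n c A Y S S' / Zg L n c A Y Ng S else 0)
    + (1 / 2) * (if S' ∈ Np S then wp L n c Y S S' / Zp L n c Y Np S else 0)

/-- The informed Bayesian CART Metropolis–Hastings transition matrix. -/
def infBcartP (L n : ℕ) (c A : ℝ) (Y : Fin n → ℝ) : Finset ℕ → Finset ℕ → ℝ :=
  mhTrans L (post L n (splitP n c) Y) (infProp L n c A Y (bNg L) bNp)

/-- The informed Twiggy Bayesian CART Metropolis–Hastings transition matrix. -/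
def infTwiggyP (L n : ℕ) (c A : ℝ) (Y : Fin n → ℝ) : Finset ℕ → Finset ℕ → ℝ :=
  mhTrans L (post L n (splitP n c) Y) (infProp L n c A Y (tNg L) tNp)

/-! ## Drift functions -/

/-- The first drift function
`V₁(𝒯) = exp{(2^L (C+2)² (n+1))^{-1} · Y'(I − P_𝒯/n)Y}`, where
`Y' P_𝒯 Y = Σ_{j ∈ 𝒯_int} (X_j'Y)²` for the orthogonal Haar design. -/
def V1 (L n : ℕ) (C : ℝ) (Y : Fin n → ℝ) (S : Finset ℕ) : ℝ :=
  Real.exp ((1 / (2 ^ L * (C + 2) ^ 2 * ((n : ℝ) + 1))) *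
    ((∑ i, Y i ^ 2) - (1 / (n : ℝ)) * ∑ j ∈ S, colDot n Y j ^ 2))

/-- The second drift function
`V₂(𝒯) = exp{2^{-L}(|𝒯_int ∖ 𝒯*_int| + min(|𝒯*_int ∖ 𝒯_int|,1)·(2^L − |𝒯_int ∪ 𝒯*_int|))}`. -/
def V2 (L : ℕ) (Sstar S : Finset ℕ) : ℝ :=
  Real.exp ((1 / 2 ^ L) * (((S \ Sstar).card : ℝ) +
    min (((Sstar \ S).card : ℝ)) 1 * ((2 ^ L : ℝ) - ((S ∪ Sstar).card : ℝ))))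

/-- Drift ratio `R(𝒯, 𝒯̃) = V(𝒯̃)/V(𝒯) − 1`. -/
def driftR (V : Finset ℕ → ℝ) (S S' : Finset ℕ) : ℝ := V S' / V S - 1

/-- `(PV)(𝒯) = Σ_{𝒯̃ ∈ 𝕋_L} V(𝒯̃) P(𝒯, 𝒯̃)`. -/
def PV (L : ℕ) (P : Finset ℕ → Finset ℕ → ℝ) (V : Finset ℕ → ℝ) (S : Finset ℕ) : ℝ :=
  ∑ T ∈ trees L, V T * P S T

/-! ## Canonical paths -/

/-- The Bayesian CART canonical transition map `𝒢` toward `𝒯*`: if the tree has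
redundant internal nodes, remove the deepest rightmost one (maximal `j = 2^l + k`);
otherwise (when `𝒯 ⊂ 𝒯*`) add the deepest rightmost external node lying in `𝒯*_int`. -/
def gMap (Sstar S : Finset ℕ) : Finset ℕ :=
  if S = Sstar then S
  else
    match (S \ Sstar).max with
    | some j => S.erase j
    | none =>
      match ((extSet S) ∩ Sstar).max with
      | some j => insert j S
      | none => S

/-- The Twiggy canonical transition map toward `𝒯*`: if the tree has redundant
internal nodes, remove the shallowest leftmost one whose internal descendants form a
twig, together with its whole twig of descendants; otherwise grow the twig toward the
deepest rightmost node of `𝒯*_int` missing from `𝒯`. -/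
def gTwig (Sstar S : Finset ℕ) : Finset ℕ :=
  if S = Sstar then S
  else
    match ((S \ Sstar).filter fun j =>
        ∀ a ∈ descIn S j, ∀ b ∈ descIn S j, a = b ∨ isAnc a b ∨ isAnc b a).min with
    | some j => pruneTwig S j
    | none =>
      match (Sstar \ S).max with
      | some j => growTwig S j
      | none => S

/-- The set of states on the canonical path from `S` to `𝒯*` (iterating the
transition map `g`; `g` fixes `𝒯*`, and the fuel `2^(2L+2)` is ample). -/
def pathStates (L : ℕ) (g : Finset ℕ → Finset ℕ) (S : Finset ℕ) : Finset (Finset ℕ) :=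
  (Finset.range (2 ^ (2 * L + 2) + 1)).image fun t => g^[t] S

/-- The length `|T_{𝒯,𝒯'}|` of the collapsed canonical path between `𝒯` and `𝒯'`:
the number of states of either path to `𝒯*` that are not on the other path. -/
def pathLen (L : ℕ) (g : Finset ℕ → Finset ℕ) (S S' : Finset ℕ) : ℕ :=
  (pathStates L g S \ pathStates L g S').card + (pathStates L g S' \ pathStates L g S).card

/-- The directed edges traversed by the canonical path from `S` to `𝒯*`. -/
def pathEdges (L : ℕ) (g : Finset ℕ → Finset ℕ) (S : Finset ℕ) :
    Finset (Finset ℕ × Finset ℕ) :=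
  ((Finset.range (2 ^ (2 * L + 2))).image fun t => (g^[t] S, g^[t + 1] S)).filter
    fun e => e.1 ≠ e.2

/-- The edge `e` lies on the collapsed canonical path `T_{𝒯,𝒯'}` (in the forward
direction along `T_{𝒯,𝒯*}`, or backward along `T_{𝒯',𝒯*}`), the common portion of
the two paths being removed. -/
def onPath (L : ℕ) (g : Finset ℕ → Finset ℕ) (e : Finset ℕ × Finset ℕ)
    (S S' : Finset ℕ) : Prop :=
  (e ∈ pathEdges L g S ∧ e ∉ pathEdges L g S') ∨
    (e.swap ∈ pathEdges L g S' ∧ e.swap ∉ pathEdges L g S)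

instance (L : ℕ) (g : Finset ℕ → Finset ℕ) (e : Finset ℕ × Finset ℕ) (S S' : Finset ℕ) :
    Decidable (onPath L g e S S') := by unfold onPath; infer_instance

end BayesCART

namespace BayesCART

/-! ## Gaussian tails -/

lemma hasSubgaussianMGF_gaussianReal :
    ProbabilityTheory.HasSubgaussianMGF id 1 (ProbabilityTheory.gaussianReal 0 1) where
  integrable_exp_mul t := ProbabilityTheory.integrable_exp_mul_gaussianReal t
  mgf_le t := by
    rw [ProbabilityTheory.mgf_gaussianReal (μ := 0) (v := 1) (by simp)]
    simp

instance (n : ℕ) : IsProbabilityMeasure (gauss n) := by unfold gauss; infer_instance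

lemma gauss_linear_tail (n : ℕ) (a : Fin n → ℝ) {v t : ℝ} (hv : ∑ i, a i ^ 2 = v)
    (ht : 0 ≤ t) :
    (gauss n).real {ε | t ≤ ∑ i, a i * ε i} ≤ Real.exp (-t ^ 2 / (2 * v)) := by
  have hind : ProbabilityTheory.iIndepFun (fun i (ε : Fin n → ℝ) => a i * ε i) (gauss n) :=
    ProbabilityTheory.iIndepFun_pi (X := fun i x => a i * x) fun i => by fun_prop
  have hsub : ∀ i ∈ (Finset.univ : Finset (Fin n)), ProbabilityTheory.HasSubgaussianMGF
      (fun ε : Fin n → ℝ => a i * ε i) (a i ^ 2).toNNReal (gauss n) := by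
    intro i _
    have hmap : (gauss n).map (Function.eval i) = ProbabilityTheory.gaussianReal 0 1 :=
      (measurePreserving_eval (fun _ : Fin n => ProbabilityTheory.gaussianReal 0 1) i).map_eq
    have := hasSubgaussianMGF_gaussianReal
    rw [← hmap] at this
    have hmeas : AEMeasurable (Function.eval i) (gauss n) := (measurable_pi_apply i).aemeasurable
    have := (ProbabilityTheory.HasSubgaussianMGF.of_map hmeas this).const_mul (a i)
    rw [← mul_one (a i ^ 2).toNNReal, Real.toNNReal_of_nonneg (sq_nonneg _)]
    exact this
  have := ProbabilityTheory.HasSubgaussianMGF.measure_sum_ge_le_of_iIndepFun hind hsub ht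
  refine this.trans (le_of_eq ?_)
  congr 3
  rw [← hv]
  push_cast
  exact Finset.sum_congr rfl fun i _ => Real.coe_toNNReal _ (sq_nonneg _)

lemma gauss_linear_abs_tail (n : ℕ) (a : Fin n → ℝ) {v t : ℝ} (hv : ∑ i, a i ^ 2 = v)
    (ht : 0 ≤ t) :
    (gauss n).real {ε | t < |∑ i, a i * ε i|} ≤ 2 * Real.exp (-t ^ 2 / (2 * v)) := by
  have h1 := gauss_linear_tail n a hv ht
  have h2 := gauss_linear_tail n (fun i => -a i) (v := v) (by simpa using hv) ht
  have hsub : {ε : Fin n → ℝ | t < |∑ i, a i * ε i|} ⊆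
      {ε | t ≤ ∑ i, a i * ε i} ∪ {ε | t ≤ ∑ i, -a i * ε i} := by
    intro ε hε
    simp only [Set.mem_union, Set.mem_ofPred_eq, neg_mul, Finset.sum_neg_distrib] at hε ⊢
    rcases lt_abs.1 hε with h | h
    · exact Or.inl h.le
    · exact Or.inr h.le
  calc _ ≤ _ := measureReal_mono hsub
    _ ≤ _ := measureReal_union_le _ _
    _ ≤ _ := by linarith

/-- Union bound over finitely many linear functionals of a standard Gaussian vector. -/
lemma gauss_max_tail (n : ℕ) (s : Finset ℕ) (a : ℕ → Fin n → ℝ) {v t : ℝ}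
    (hv : ∀ j ∈ s, ∑ i, a j i ^ 2 = v) (ht : 0 ≤ t) {S : Set (Fin n → ℝ)}
    (hS : ∀ ε : Fin n → ℝ, (∀ j ∈ s, |∑ i, a j i * ε i| ≤ t) → ε ∈ S) :
    1 - s.card * (2 * Real.exp (-t ^ 2 / (2 * v))) ≤ (gauss n).real S := by
  have hcov : (Set.univ : Set (Fin n → ℝ)) ⊆
      S ∪ ⋃ j ∈ s, {ε : Fin n → ℝ | t < |∑ i, a j i * ε i|} := by
    intro ε _
    by_cases h : ∀ j ∈ s, |∑ i, a j i * ε i| ≤ t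
    · exact Or.inl (hS ε h)
    · push Not at h
      obtain ⟨j, hj, hlt⟩ := h
      exact Or.inr (Set.mem_biUnion hj hlt)
  have h1 : (1 : ℝ) ≤ (gauss n).real S +
      (gauss n).real (⋃ j ∈ s, {ε : Fin n → ℝ | t < |∑ i, a j i * ε i|}) := by
    calc (1 : ℝ) = (gauss n).real Set.univ := by simp
      _ ≤ _ := measureReal_mono hcov
      _ ≤ _ := measureReal_union_le _ _
  have h2 := measureReal_biUnion_finset_le (μ := gauss n) s
    (fun j => {ε : Fin n → ℝ | t < |∑ i, a j i * ε i|})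
  have h3 := Finset.sum_le_sum fun j hj => gauss_linear_abs_tail n (a j) (hv j hj) ht
  rw [Finset.sum_const, nsmul_eq_mul] at h3
  linarith

/-! ## Orthogonality of the Haar design -/

/-- Up to scaling, the `j`-th Haar column is `1` on the design points below the left child
`2j` and `-1` on those below the right child `2j+1`, the `i`-th design point being the node
`2^(M+1) + i`. -/
lemma haarCol_eq {M j i : ℕ} (hj : j ≠ 0) (hl : Nat.log 2 j ≤ M) :
    haarCol (2 ^ (M + 1)) j i = (2 : ℝ) ^ ((Nat.log 2 j : ℝ) / 2) *
      (if (2 ^ (M + 1) + i) / 2 ^ (M - Nat.log 2 j) = 2 * j then 1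
        else if (2 ^ (M + 1) + i) / 2 ^ (M - Nat.log 2 j) = 2 * j + 1 then -1 else 0) := by
  unfold haarCol
  rw [if_neg hj]
  congr 1
  set l := Nat.log 2 j with hldef
  obtain ⟨d, rfl⟩ := Nat.exists_eq_add_of_le hl
  obtain ⟨k, hk⟩ := Nat.exists_eq_add_of_le (Nat.pow_log_le_self 2 hj)
  rw [← hldef] at hk
  rw [Nat.add_sub_cancel_left, hk, Nat.add_sub_cancel_left]
  unfold haarMother
  have hm : 0 < 2 ^ d := by positivity
  have hN : 2 ^ (l + d + 1) = 2 ^ d * (2 * 2 ^ l) := by ring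
  have hx : (2 : ℝ) ^ l * ((i + 1 : ℝ) / ((2 ^ (l + d + 1) : ℕ) : ℝ)) = (i + 1) / (2 * 2 ^ d) := by
    push_cast
    rw [pow_add, pow_add]
    field_simp
  rw [hx]
  have hmr : (0 : ℝ) < 2 ^ d := by positivity
  have hpos : (0 : ℝ) < 2 * 2 ^ d := by positivity
  have hdiv : ∀ q, (2 ^ (l + d + 1) + i) / 2 ^ d = 2 * 2 ^ l + q ↔
      q * 2 ^ d ≤ i ∧ i < (q + 1) * 2 ^ d := by
    intro q
    rw [hN, Nat.mul_add_div hm, Nat.add_left_cancel_iff, Nat.div_eq_iff hm]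
    generalize 2 ^ d = m at *
    rw [add_mul]
    omega
  have e1 : 2 * (2 ^ l + k) = 2 * 2 ^ l + 2 * k := by ring
  have e2 : 2 * (2 ^ l + k) + 1 = 2 * 2 ^ l + (2 * k + 1) := by ring
  have c1 : (0 < ((i : ℝ) + 1) / (2 * 2 ^ d) - k ∧ ((i : ℝ) + 1) / (2 * 2 ^ d) - k ≤ 1 / 2) ↔
      (2 ^ (l + d + 1) + i) / 2 ^ d = 2 * (2 ^ l + k) := by
    rw [e1, hdiv, sub_pos, lt_div_iff₀ hpos, sub_le_iff_le_add, div_le_iff₀ hpos]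
    constructor
    · rintro ⟨h1, h2⟩
      have h1' : k * (2 * 2 ^ d) < i + 1 := by exact_mod_cast h1
      have h2' : (i : ℝ) + 1 ≤ (2 * k + 1) * 2 ^ d := by linarith
      have h2'' : i + 1 ≤ (2 * k + 1) * 2 ^ d := by exact_mod_cast h2'
      constructor <;> linarith
    · rintro ⟨h1, h2⟩
      have h1' : k * (2 * 2 ^ d) < i + 1 := by linarith
      have h2' : i + 1 ≤ (2 * k + 1) * 2 ^ d := by linarith
      have h1'' : (k : ℝ) * (2 * 2 ^ d) < i + 1 := by exact_mod_cast h1'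
      have h2'' : (i : ℝ) + 1 ≤ (2 * k + 1) * 2 ^ d := by exact_mod_cast h2'
      constructor <;> linarith
  have c2 : (1 / 2 < ((i : ℝ) + 1) / (2 * 2 ^ d) - k ∧ ((i : ℝ) + 1) / (2 * 2 ^ d) - k ≤ 1) ↔
      (2 ^ (l + d + 1) + i) / 2 ^ d = 2 * (2 ^ l + k) + 1 := by
    rw [e2, hdiv, lt_sub_iff_add_lt, lt_div_iff₀ hpos, sub_le_iff_le_add, div_le_iff₀ hpos]
    constructor
    · rintro ⟨h1, h2⟩
      have h1' : (2 * (k : ℝ) + 1) * 2 ^ d < i + 1 := by linarith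
      have h1'' : (2 * k + 1) * 2 ^ d < i + 1 := by exact_mod_cast h1'
      have h2' : (i : ℝ) + 1 ≤ (2 * k + 1 + 1) * 2 ^ d := by linarith
      have h2'' : i + 1 ≤ (2 * k + 1 + 1) * 2 ^ d := by exact_mod_cast h2'
      constructor <;> linarith
    · rintro ⟨h1, h2⟩
      have h1' : (2 * k + 1) * 2 ^ d < i + 1 := by linarith
      have h2' : i + 1 ≤ (2 * k + 1 + 1) * 2 ^ d := by linarith
      have h1'' : (2 * (k : ℝ) + 1) * 2 ^ d < i + 1 := by exact_mod_cast h1'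
      have h2'' : (i : ℝ) + 1 ≤ (2 * k + 1 + 1) * 2 ^ d := by exact_mod_cast h2'
      constructor <;> linarith
  simp only [c1, c2]

lemma card_filter_div {M l q : ℕ} (hl : l ≤ M) (h1 : 2 ^ (l + 1) ≤ q) (h2 : q < 2 ^ (l + 2)) :
    ((Finset.range (2 ^ (M + 1))).filter
      fun i => (2 ^ (M + 1) + i) / 2 ^ (M - l) = q).card = 2 ^ (M - l) := by
  obtain ⟨d, rfl⟩ := Nat.exists_eq_add_of_le hl
  obtain ⟨r, rfl⟩ := Nat.exists_eq_add_of_le h1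
  rw [Nat.add_sub_cancel_left]
  have hm : 0 < 2 ^ d := by positivity
  have hN : 2 ^ (l + d + 1) = 2 ^ d * 2 ^ (l + 1) := by ring
  have hr : r + 1 ≤ 2 ^ (l + 1) := by
    rw [show l + 2 = (l + 1) + 1 by ring, pow_succ 2 (l + 1)] at h2
    omega
  have hlt : (r + 1) * 2 ^ d ≤ 2 ^ (l + d + 1) := by
    rw [hN, mul_comm]; exact Nat.mul_le_mul_left _ hr
  have : ((Finset.range (2 ^ (l + d + 1))).filter
      fun i => (2 ^ (l + d + 1) + i) / 2 ^ d = 2 ^ (l + 1) + r) =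
      Finset.Ico (r * 2 ^ d) ((r + 1) * 2 ^ d) := by
    ext i
    simp only [Finset.mem_filter, Finset.mem_range, Finset.mem_Ico]
    have hd : (2 ^ (l + d + 1) + i) / 2 ^ d = 2 ^ (l + 1) + r ↔
        r * 2 ^ d ≤ i ∧ i < (r + 1) * 2 ^ d := by
      rw [hN, Nat.mul_add_div hm, Nat.add_left_cancel_iff, Nat.div_eq_iff hm]
      generalize 2 ^ d = m at *
      rw [add_mul]
      omega
    rw [hd]
    constructor
    · exact fun h => h.2
    · exact fun h => ⟨h.2.trans_le hlt, h⟩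
  rw [this, Nat.card_Ico, add_mul, one_mul, Nat.add_sub_cancel_left]

lemma card_filter_children {M j b : ℕ} (hj : j ≠ 0) (hl : Nat.log 2 j ≤ M) (hb : b < 2) :
    ((Finset.range (2 ^ (M + 1))).filter
      fun i => (2 ^ (M + 1) + i) / 2 ^ (M - Nat.log 2 j) = 2 * j + b).card =
      2 ^ (M - Nat.log 2 j) := by
  have h1 := Nat.pow_log_le_self 2 hj
  have h2 := Nat.lt_pow_succ_log_self (b := 2) (by norm_num) j
  refine card_filter_div hl ?_ ?_
  · rw [pow_succ]; omega
  · rw [show Nat.log 2 j + 2 = (Nat.log 2 j).succ + 1 by rfl, pow_succ 2 (Nat.log 2 j).succ]; omega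

lemma sum_haarCol {M j : ℕ} (hj : j ≠ 0) (hl : Nat.log 2 j ≤ M) :
    ∑ i ∈ Finset.range (2 ^ (M + 1)), haarCol (2 ^ (M + 1)) j i = 0 := by
  have h0 := card_filter_children hj hl (b := 0) (by norm_num)
  have h1 := card_filter_children hj hl (b := 1) (by norm_num)
  rw [add_zero] at h0
  simp only [haarCol_eq hj hl]
  rw [← Finset.mul_sum]
  have : ∀ i, (if (2 ^ (M + 1) + i) / 2 ^ (M - Nat.log 2 j) = 2 * j then (1 : ℝ)
        else if (2 ^ (M + 1) + i) / 2 ^ (M - Nat.log 2 j) = 2 * j + 1 then -1 else 0) =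
      (if (2 ^ (M + 1) + i) / 2 ^ (M - Nat.log 2 j) = 2 * j then (1 : ℝ) else 0) -
      (if (2 ^ (M + 1) + i) / 2 ^ (M - Nat.log 2 j) = 2 * j + 1 then (1 : ℝ) else 0) := by
    intro i
    split_ifs <;> first | omega | norm_num
  simp only [this]
  rw [Finset.sum_sub_distrib, Finset.sum_boole, Finset.sum_boole, h0, h1]
  simp

lemma sum_haarCol_sq {M j : ℕ} (hl : Nat.log 2 j ≤ M) :
    ∑ i ∈ Finset.range (2 ^ (M + 1)), haarCol (2 ^ (M + 1)) j i ^ 2 = 2 ^ (M + 1) := by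
  rcases eq_or_ne j 0 with rfl | hj
  · simp [haarCol]
  have h0 := card_filter_children hj hl (b := 0) (by norm_num)
  have h1 := card_filter_children hj hl (b := 1) (by norm_num)
  rw [add_zero] at h0
  simp only [haarCol_eq hj hl, mul_pow]
  rw [← Finset.mul_sum]
  have : ∀ i, (if (2 ^ (M + 1) + i) / 2 ^ (M - Nat.log 2 j) = 2 * j then (1 : ℝ)
        else if (2 ^ (M + 1) + i) / 2 ^ (M - Nat.log 2 j) = 2 * j + 1 then -1 else 0) ^ 2 =
      (if (2 ^ (M + 1) + i) / 2 ^ (M - Nat.log 2 j) = 2 * j then (1 : ℝ) else 0) +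
      (if (2 ^ (M + 1) + i) / 2 ^ (M - Nat.log 2 j) = 2 * j + 1 then (1 : ℝ) else 0) := by
    intro i
    split_ifs <;> first | omega | norm_num
  simp only [this]
  rw [Finset.sum_add_distrib, Finset.sum_boole, Finset.sum_boole, h0, h1]
  have hsq : ((2 : ℝ) ^ ((Nat.log 2 j : ℝ) / 2)) ^ 2 = 2 ^ Nat.log 2 j := by
    rw [← Real.rpow_natCast, ← Real.rpow_mul (by norm_num)]
    push_cast
    rw [div_mul_cancel₀ _ (by norm_num), Real.rpow_natCast]
  rw [hsq]
  push_cast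
  rw [← two_mul, mul_left_comm, ← pow_add, Nat.add_sub_of_le hl, pow_succ]
  ring

/-- On the support of a finer column, a coarser column is constant. -/
lemma haarCol_mul_eq_const {M j k : ℕ} (hjk : j ≠ k) (hk : k ≠ 0)
    (hlog : Nat.log 2 j ≤ Nat.log 2 k) (hl : Nat.log 2 k ≤ M) :
    ∃ a : ℝ, ∀ i, haarCol (2 ^ (M + 1)) j i * haarCol (2 ^ (M + 1)) k i =
      a * haarCol (2 ^ (M + 1)) k i := by
  rcases eq_or_ne j 0 with rfl | hj
  · exact ⟨1, fun i => by simp [haarCol]⟩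
  rcases hlog.eq_or_lt with heq | hlt
  · refine ⟨0, fun i => ?_⟩
    rw [haarCol_eq hj (hlog.trans hl), haarCol_eq hk hl, heq]
    split_ifs <;> first | omega | simp
  · obtain ⟨d, hd⟩ := Nat.exists_eq_add_of_lt hlt
    refine ⟨(2 : ℝ) ^ ((Nat.log 2 j : ℝ) / 2) *
      (if k / 2 ^ d = 2 * j then 1 else if k / 2 ^ d = 2 * j + 1 then -1 else 0), fun i => ?_⟩
    have hdiv : (2 ^ (M + 1) + i) / 2 ^ (M - Nat.log 2 j) =
        (2 ^ (M + 1) + i) / 2 ^ (M - Nat.log 2 k) / 2 / 2 ^ d := by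
      rw [Nat.div_div_eq_div_mul, Nat.div_div_eq_div_mul, ← pow_succ', ← pow_add]
      congr 2
      omega
    rw [haarCol_eq hj (hlog.trans hl), haarCol_eq hk hl, hdiv]
    by_cases h0 : (2 ^ (M + 1) + i) / 2 ^ (M - Nat.log 2 k) = 2 * k
    · rw [h0, Nat.mul_div_cancel_left _ (by norm_num)]
    by_cases h1 : (2 ^ (M + 1) + i) / 2 ^ (M - Nat.log 2 k) = 2 * k + 1
    · rw [h1, show (2 * k + 1) / 2 = k by omega]
    · rw [if_neg h0, if_neg h1]
      simp

lemma sum_haarCol_mul_of_log_le {M j k : ℕ} (hjk : j ≠ k) (hk : k ≠ 0)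
    (hlog : Nat.log 2 j ≤ Nat.log 2 k) (hl : Nat.log 2 k ≤ M) :
    ∑ i ∈ Finset.range (2 ^ (M + 1)),
      haarCol (2 ^ (M + 1)) j i * haarCol (2 ^ (M + 1)) k i = 0 := by
  obtain ⟨a, ha⟩ := haarCol_mul_eq_const hjk hk hlog hl
  simp only [ha]
  rw [← Finset.mul_sum, sum_haarCol hk hl, mul_zero]

lemma sum_haarCol_mul {M j k : ℕ} (hjk : j ≠ k) (hj : Nat.log 2 j ≤ M) (hk : Nat.log 2 k ≤ M) :
    ∑ i ∈ Finset.range (2 ^ (M + 1)),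
      haarCol (2 ^ (M + 1)) j i * haarCol (2 ^ (M + 1)) k i = 0 := by
  wlog h : k ≠ 0 ∧ Nat.log 2 j ≤ Nat.log 2 k generalizing j k
  · have h' : j ≠ 0 ∧ Nat.log 2 k ≤ Nat.log 2 j := by
      rcases eq_or_ne k 0 with rfl | hk0
      · exact ⟨hjk, by simp⟩
      · have : Nat.log 2 k < Nat.log 2 j := not_le.1 fun hle => h ⟨hk0, hle⟩
        refine ⟨?_, this.le⟩
        rintro rfl
        simp at this
    simp only [mul_comm (haarCol _ j _)]
    exact this hjk.symm hk hj h'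
  · exact sum_haarCol_mul_of_log_le hjk h.1 h.2 hk

lemma log_le_of_lt_two_pow {L M j : ℕ} (hLM : L ≤ M) (hj : j < 2 ^ L) : Nat.log 2 j ≤ M := by
  rcases eq_or_ne j 0 with rfl | h0
  · simp
  · exact (Nat.log_lt_of_lt_pow h0 hj).le.trans hLM

lemma sum_haarCol_fin_sq {L M j : ℕ} (hLM : L ≤ M) (hj : j < 2 ^ L) :
    ∑ i : Fin (2 ^ (M + 1)), haarCol (2 ^ (M + 1)) j i.val ^ 2 = 2 ^ (M + 1) := by
  rw [Fin.sum_univ_eq_sum_range (fun i => haarCol (2 ^ (M + 1)) j i ^ 2)]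
  exact sum_haarCol_sq (log_le_of_lt_two_pow hLM hj)

/-- By orthogonality `X_j'Y = n β_j + X_j'ε`. -/
lemma colDot_Yvec {L M : ℕ} (hLM : L ≤ M) {β : ℕ → ℝ} {B : Finset ℕ}
    (hB : ∀ j ∈ B, j < 2 ^ L) (hβ : ∀ j, j ∉ B → β j = 0) (ε : Fin (2 ^ (M + 1)) → ℝ)
    {j : ℕ} (hj : j < 2 ^ L) :
    colDot (2 ^ (M + 1)) (Yvec (2 ^ (M + 1)) β B ε) j =
      2 ^ (M + 1) * β j + colDot (2 ^ (M + 1)) ε j := by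
  have hlogj := log_le_of_lt_two_pow hLM hj
  unfold colDot Yvec signalVec
  simp only [mul_add, Finset.sum_add_distrib, Finset.mul_sum]
  congr 1
  rw [Finset.sum_comm]
  have hterm : ∀ k ∈ B, ∑ i : Fin (2 ^ (M + 1)),
      haarCol (2 ^ (M + 1)) j i.val * (β k * haarCol (2 ^ (M + 1)) k i.val) =
      if k = j then 2 ^ (M + 1) * β j else 0 := by
    intro k hk
    have hlogk := log_le_of_lt_two_pow hLM (hB k hk)
    rw [Fin.sum_univ_eq_sum_range
      (fun i => haarCol (2 ^ (M + 1)) j i * (β k * haarCol (2 ^ (M + 1)) k i))]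
    simp only [mul_left_comm _ (β k)]
    rw [← Finset.mul_sum]
    split_ifs with h
    · subst h
      simp only [← sq]
      rw [sum_haarCol_sq hlogk, mul_comm]
    · rw [sum_haarCol_mul (Ne.symm h) hlogj hlogk, mul_zero]
  rw [Finset.sum_congr rfl hterm, Finset.sum_ite_eq']
  split_ifs with h
  · rfl
  · rw [hβ j h, mul_zero]

/-! ## Trees, twigs and the Twiggy moves -/

lemma mem_trees {L : ℕ} {S : Finset ℕ} : S ∈ trees L ↔ IsTree L S := by
  simp only [trees, Finset.mem_filter, Finset.mem_powerset, and_iff_right_iff_imp]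
  exact fun h j hj => Finset.mem_range.2 (h.2.2 j hj)

lemma isAnc_div_pow {b t : ℕ} (hb : b ≠ 0) (ht : 1 ≤ t) : isAnc (b / 2 ^ t) b := by
  rcases le_total t b with h | h
  · exact ⟨t, Finset.mem_Icc.2 ⟨ht, h⟩, rfl⟩
  · refine ⟨b, Finset.mem_Icc.2 ⟨by omega, le_rfl⟩, ?_⟩
    rw [Nat.div_eq_of_lt Nat.lt_two_pow_self,
      Nat.div_eq_of_lt (Nat.lt_two_pow_self.trans_le (Nat.pow_le_pow_right (by norm_num) h))]

lemma isAnc_half {b : ℕ} (hb : b ≠ 0) : isAnc (b / 2) b := by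
  simpa using isAnc_div_pow hb le_rfl

lemma isAnc.lt {a b : ℕ} (h : isAnc a b) : a < b := by
  obtain ⟨t, ht, rfl⟩ := h
  rw [Finset.mem_Icc] at ht
  exact Nat.div_lt_self (by omega) (Nat.one_lt_two_pow (by omega))

lemma isAnc.trans {a b c : ℕ} (h : isAnc a b) (h' : isAnc b c) : isAnc a c := by
  have hc : c ≠ 0 := by have := h'.lt; omega
  obtain ⟨t, ht, rfl⟩ := h
  obtain ⟨s, hs, rfl⟩ := h'
  rw [Finset.mem_Icc] at ht
  rw [Nat.div_div_eq_div_mul, ← pow_add]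
  exact isAnc_div_pow hc (by omega)

lemma mem_ancPath {a b : ℕ} : a ∈ ancPath b ↔ a = b ∨ isAnc a b := by
  simp only [ancPath, Finset.mem_image, Finset.mem_range]
  constructor
  · rintro ⟨t, ht, rfl⟩
    rcases Nat.eq_zero_or_pos t with rfl | h
    · simp
    · exact Or.inr ⟨t, Finset.mem_Icc.2 ⟨h, by omega⟩, rfl⟩
  · rintro (rfl | ⟨t, ht, rfl⟩)
    · exact ⟨0, by omega, by simp⟩
    · exact ⟨t, by rw [Finset.mem_Icc] at ht; omega, rfl⟩

lemma self_mem_ancPath (b : ℕ) : b ∈ ancPath b := mem_ancPath.2 (Or.inl rfl)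

lemma le_of_mem_ancPath {a b : ℕ} (h : a ∈ ancPath b) : a ≤ b := by
  rcases mem_ancPath.1 h with rfl | h
  · exact le_rfl
  · exact h.lt.le

lemma half_mem_ancPath {a b : ℕ} (h : a ∈ ancPath b) (ha : a ≠ 0) : a / 2 ∈ ancPath b := by
  rcases mem_ancPath.1 h with rfl | h
  · exact mem_ancPath.2 (Or.inr (isAnc_half ha))
  · exact mem_ancPath.2 (Or.inr ((isAnc_half ha).trans h))

lemma ancPath_comparable {m x y : ℕ} (hx : x ∈ ancPath m) (hy : y ∈ ancPath m) :
    x = y ∨ isAnc x y ∨ isAnc y x := by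
  simp only [ancPath, Finset.mem_image, Finset.mem_range] at hx hy
  obtain ⟨s, -, rfl⟩ := hx
  obtain ⟨t, -, rfl⟩ := hy
  have key : ∀ s t : ℕ, s ≤ t → m / 2 ^ s = m / 2 ^ t ∨ isAnc (m / 2 ^ t) (m / 2 ^ s) := by
    intro s t hst
    obtain ⟨d, rfl⟩ := Nat.exists_eq_add_of_le hst
    rw [pow_add, ← Nat.div_div_eq_div_mul]
    rcases Nat.eq_zero_or_pos d with rfl | hd
    · simp
    · by_cases h0 : m / 2 ^ s = 0
      · simp [h0]
      · exact Or.inr (isAnc_div_pow h0 hd)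
  rcases le_total s t with h | h
  · rcases key s t h with h | h
    · exact Or.inl h
    · exact Or.inr (Or.inr h)
  · rcases key t s h with h | h
    · exact Or.inl h.symm
    · exact Or.inr (Or.inl h)

lemma ancPath_card_le {L m : ℕ} (hm : m < 2 ^ L) : (ancPath m).card ≤ L + 1 := by
  have hsub : ancPath m ⊆ (Finset.range (L + 1)).image fun t => m / 2 ^ t := by
    intro x hx
    simp only [ancPath, Finset.mem_image, Finset.mem_range] at hx ⊢
    obtain ⟨t, -, rfl⟩ := hx
    rcases le_total t L with h | h
    · exact ⟨t, by omega, rfl⟩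
    · refine ⟨L, by omega, ?_⟩
      rw [Nat.div_eq_of_lt hm,
        Nat.div_eq_of_lt (hm.trans_le (Nat.pow_le_pow_right (by norm_num) h))]
  calc _ ≤ _ := Finset.card_le_card hsub
    _ ≤ _ := Finset.card_image_le
    _ = _ := Finset.card_range _

lemma IsTree.div_pow_mem {L : ℕ} {S : Finset ℕ} (hS : IsTree L S) {j : ℕ} (hj : j ∈ S) (t : ℕ) :
    j / 2 ^ t ∈ S := by
  induction t with
  | zero => simpa
  | succ t ih =>
    rw [pow_succ, ← Nat.div_div_eq_div_mul]
    by_cases h0 : j / 2 ^ t = 0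
    · rw [h0]; exact hS.1
    · exact hS.2.1 _ ih (Nat.pos_of_ne_zero h0)

lemma IsTree.mem_of_isAnc {L : ℕ} {S : Finset ℕ} (hS : IsTree L S) {a j : ℕ} (hj : j ∈ S)
    (h : isAnc a j) : a ∈ S := by
  obtain ⟨t, -, rfl⟩ := h
  exact hS.div_pow_mem hj t

lemma IsTree.ancPath_subset {L : ℕ} {S : Finset ℕ} (hS : IsTree L S) {j : ℕ} (hj : j ∈ S) :
    ancPath j ⊆ S := by
  intro a ha
  rcases mem_ancPath.1 ha with rfl | h
  · exact hj
  · exact hS.mem_of_isAnc hj h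

lemma isTree_growTwig {L : ℕ} {S : Finset ℕ} (hS : IsTree L S) {m : ℕ} (hm : m < 2 ^ L) :
    IsTree L (growTwig S m) := by
  refine ⟨Finset.mem_union_left _ hS.1, fun j hj h1 => ?_, fun j hj => ?_⟩
  · rcases Finset.mem_union.1 hj with h | h
    · exact Finset.mem_union_left _ (hS.2.1 j h h1)
    · exact Finset.mem_union_right _ (half_mem_ancPath h (by omega))
  · rcases Finset.mem_union.1 hj with h | h
    · exact hS.2.2 j h
    · exact (le_of_mem_ancPath h).trans_lt hm

lemma mem_pruneTwig {S : Finset ℕ} {j k : ℕ} :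
    k ∈ pruneTwig S j ↔ k ∈ S ∧ k ≠ j ∧ ¬ isAnc j k := by
  simp only [pruneTwig, descIn, Finset.mem_sdiff, Finset.mem_insert, Finset.mem_filter]
  tauto

lemma pruneTwig_subset (S : Finset ℕ) (j : ℕ) : pruneTwig S j ⊆ S := Finset.sdiff_subset

lemma isTree_pruneTwig {L : ℕ} {S : Finset ℕ} (hS : IsTree L S) {j : ℕ} (hj : j ≠ 0) :
    IsTree L (pruneTwig S j) := by
  refine ⟨mem_pruneTwig.2 ⟨hS.1, hj.symm, fun h => ?_⟩, fun k hk h1 => ?_, fun k hk => ?_⟩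
  · exact absurd h.lt (Nat.not_lt_zero _)
  · rw [mem_pruneTwig] at hk ⊢
    have hhalf := isAnc_half (b := k) (by omega)
    refine ⟨hS.2.1 k hk.1 h1, ?_, fun h => hk.2.2 (h.trans hhalf)⟩
    rintro rfl
    exact hk.2.2 hhalf
  · exact hS.2.2 k (pruneTwig_subset S j hk)

/-- Every Twiggy PRUNE is undone by a GROW. -/
lemma exists_growTwig_pruneTwig {L : ℕ} {S : Finset ℕ} (hS : IsTree L S) {j : ℕ}
    (hj : j ∈ twigPruneCands S) :
    ∃ m ∈ S, m ∉ pruneTwig S j ∧ growTwig (pruneTwig S j) m = S := by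
  simp only [twigPruneCands, Finset.mem_filter] at hj
  obtain ⟨hjS, hj0, hchain⟩ := hj
  have hne : (insert j (descIn S j)).Nonempty := Finset.insert_nonempty _ _
  set m := (insert j (descIn S j)).max' hne with hm
  have hmem : m ∈ insert j (descIn S j) := Finset.max'_mem _ hne
  have hmax : ∀ k ∈ insert j (descIn S j), k ≤ m := fun k hk => Finset.le_max' _ k hk
  have hmS : m ∈ S := by
    rcases Finset.mem_insert.1 hmem with h | h
    · rw [h]; exact hjS
    · exact (Finset.mem_filter.1 h).1
  have hcomp : ∀ k ∈ insert j (descIn S j), k ∈ ancPath m := by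
    intro k hk
    rcases eq_or_ne k m with rfl | hkm
    · exact self_mem_ancPath _
    have hle := hmax k hk
    refine mem_ancPath.2 (Or.inr ?_)
    rcases Finset.mem_insert.1 hmem with h | h <;> rcases Finset.mem_insert.1 hk with h' | h'
    · exact absurd (h'.trans h.symm) hkm
    · have := (Finset.mem_filter.1 h').2.lt
      omega
    · rw [h']
      exact (Finset.mem_filter.1 h).2
    · rcases hchain k h' m h with h1 | h1 | h1
      · exact absurd h1 hkm
      · exact h1
      · have := h1.lt
        omega
  refine ⟨m, hmS, fun h => (Finset.mem_sdiff.1 h).2 hmem, ?_⟩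
  apply Finset.Subset.antisymm
  · exact Finset.union_subset (pruneTwig_subset _ _) (hS.ancPath_subset hmS)
  · intro k hk
    by_cases h : k ∈ insert j (descIn S j)
    · exact Finset.mem_union_right _ (hcomp k h)
    · exact Finset.mem_union_left _ (Finset.mem_sdiff.2 ⟨hk, h⟩)

/-- Every Twiggy GROW is undone by a PRUNE. -/
lemma exists_pruneTwig_growTwig {L : ℕ} {S : Finset ℕ} (hS : IsTree L S) {m : ℕ} (hm : m ∉ S) :
    ∃ i ∈ twigPruneCands (growTwig S m), pruneTwig (growTwig S m) i = S := by
  have hne : (ancPath m \ S).Nonempty := ⟨m, Finset.mem_sdiff.2 ⟨self_mem_ancPath m, hm⟩⟩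
  set i := (ancPath m \ S).min' hne with hi
  have hmem : i ∈ ancPath m \ S := Finset.min'_mem _ hne
  have hmin : ∀ k ∈ ancPath m \ S, i ≤ k := fun k hk => Finset.min'_le _ k hk
  rw [Finset.mem_sdiff] at hmem
  have hi0 : i ≠ 0 := by
    intro h
    rw [h] at hmem
    exact hmem.2 hS.1
  have hdesc : ∀ k ∈ growTwig S m, isAnc i k → k ∈ ancPath m ∧ k ∉ S := by
    intro k hk hik
    have hkS : k ∉ S := fun h => hmem.2 (hS.mem_of_isAnc h hik)
    rcases Finset.mem_union.1 hk with h | h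
    · exact absurd h hkS
    · exact ⟨h, hkS⟩
  refine ⟨i, ?_, ?_⟩
  · refine Finset.mem_filter.2 ⟨Finset.mem_union_right _ hmem.1, hi0, fun a ha b hb => ?_⟩
    rw [descIn, Finset.mem_filter] at ha hb
    exact ancPath_comparable (hdesc a ha.1 ha.2).1 (hdesc b hb.1 hb.2).1
  · ext k
    rw [mem_pruneTwig]
    constructor
    · rintro ⟨hk, hki, hanc⟩
      by_contra hkS
      have hkm : k ∈ ancPath m := (Finset.mem_union.1 hk).resolve_left hkS
      have hle := hmin k (Finset.mem_sdiff.2 ⟨hkm, hkS⟩)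
      rcases ancPath_comparable hmem.1 hkm with h | h | h
      · exact hki h.symm
      · exact hanc h
      · have := h.lt
        omega
    · intro hk
      refine ⟨Finset.mem_union_left _ hk, ?_, fun h => hmem.2 (hS.mem_of_isAnc hk h)⟩
      rintro rfl
      exact hmem.2 hk

/-! ## Lower bounds on the Twiggy proposal -/

/-- `2^L (D^L - 1)/(D - 1)`, written as a geometric sum. -/
def invRate (D : ℝ) (L : ℕ) : ℝ := 2 ^ L * ∑ l ∈ Finset.range L, D ^ l

lemma layerWt_nonneg {D : ℝ} (hD : 1 < D) (L : ℕ) (S : Finset ℕ) (l : ℕ) :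
    0 ≤ layerWt D L S l := by
  unfold layerWt
  have : 0 < D := by linarith
  positivity

lemma one_le_card_filter_eq {α γ : Type*} [DecidableEq γ] {s : Finset α} (f : α → γ) {j : α}
    (hj : j ∈ s) : (1 : ℝ) ≤ (s.filter fun i => f i = f j).card := by
  have h : 0 < (s.filter fun i => f i = f j).card :=
    Finset.card_pos.2 ⟨j, Finset.mem_filter.2 ⟨hj, rfl⟩⟩
  exact_mod_cast h

lemma pow_mul_sum_rpow_neg {D : ℝ} (hD : 0 < D) (M : ℕ) :
    D ^ M * ∑ l ∈ Finset.range (M + 1), D ^ (-(l : ℝ)) = ∑ l ∈ Finset.range (M + 1), D ^ l := by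
  rw [← Finset.sum_range_reflect, Finset.mul_sum]
  refine Finset.sum_congr rfl fun x hx => ?_
  rw [Finset.mem_range] at hx
  rw [Real.rpow_neg hD.le, Real.rpow_natCast, ← div_eq_mul_inv, div_eq_iff (by positivity),
    ← pow_add]
  congr 1
  omega

lemma layerWt_ge {D : ℝ} (hD : 1 < D) {L l : ℕ} {S : Finset ℕ} (hl : l < L)
    (hne : (layerNodes S l).Nonempty) :
    (invRate D L)⁻¹ ≤ 1 / 2 * (layerWt D L S l * (1 / 2 ^ l)) := by
  have hD0 : 0 < D := by linarith
  obtain ⟨d, rfl⟩ := Nat.exists_eq_add_of_lt hl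
  unfold layerWt
  set E := (Finset.range (l + d + 1)).filter (fun l' => (layerNodes S l').Nonempty) with hE
  have hlE : l ∈ E := Finset.mem_filter.2 ⟨Finset.mem_range.2 hl, hne⟩
  set G := ∑ l' ∈ E, D ^ (-(l' : ℝ)) with hG
  have hG0 : 0 < G := Finset.sum_pos (fun _ _ => by positivity) ⟨l, hlE⟩
  have hGle : D ^ (l + d) * G ≤ ∑ l' ∈ Finset.range (l + d + 1), D ^ l' := by
    rw [← pow_mul_sum_rpow_neg hD0]
    exact mul_le_mul_of_nonneg_left (Finset.sum_le_sum_of_subset_of_nonneg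
      (Finset.filter_subset _ _) fun _ _ _ => by positivity) (by positivity)
  have heq : 1 / 2 * (D ^ (-(l : ℝ)) / G * (1 / 2 ^ l)) = (2 ^ (l + 1) * (D ^ l * G))⁻¹ := by
    rw [pow_succ, Real.rpow_neg hD0.le, Real.rpow_natCast]
    field_simp
  rw [heq]
  apply inv_anti₀ (by positivity)
  unfold invRate
  have hpow : (2 : ℝ) ^ (l + 1) ≤ 2 ^ (l + d + 1) := pow_le_pow_right₀ (by norm_num) hl
  have hDpow : D ^ l ≤ D ^ (l + d) := pow_le_pow_right₀ hD.le (by omega)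
  calc _ ≤ (2 : ℝ) ^ (l + d + 1) * (D ^ (l + d) * G) := by gcongr
    _ ≤ _ := by gcongr

lemma twiggyProp_ge_grow {D : ℝ} (hD : 1 < D) {L : ℕ} {S : Finset ℕ} (hS : IsTree L S) {m : ℕ}
    (hm : m ∉ S) (hmL : m < 2 ^ L) :
    (invRate D L)⁻¹ ≤ twiggyProp L D S (growTwig S m) := by
  have hm0 : m ≠ 0 := by rintro rfl; exact hm hS.1
  set l := Nat.log 2 m with hl
  have hlL : l < L := Nat.log_lt_of_lt_pow hm0 hmL
  have hml : m ∈ layerNodes S l := by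
    refine Finset.mem_filter.2 ⟨Finset.mem_Ico.2 ⟨Nat.pow_log_le_self 2 hm0, ?_⟩, hm⟩
    exact Nat.lt_pow_succ_log_self (by norm_num) m
  have hcard : ((layerNodes S l).card : ℝ) ≤ 2 ^ l := by
    have : (layerNodes S l).card ≤ 2 ^ l := by
      refine (Finset.card_filter_le _ _).trans ?_
      rw [Nat.card_Ico, pow_succ]
      omega
    exact_mod_cast this
  have hcard0 : (0 : ℝ) < (layerNodes S l).card := by
    exact_mod_cast Finset.card_pos.2 ⟨m, hml⟩
  have hcard1 := one_le_card_filter_eq (growTwig S) hml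
  have hterm : ∀ l' ∈ Finset.range L, 0 ≤ layerWt D L S l' *
      ((((layerNodes S l').filter fun j => growTwig S j = growTwig S m).card : ℝ) /
        (layerNodes S l').card) := fun l' _ =>
    mul_nonneg (layerWt_nonneg hD L S l') (by positivity)
  have hsum := Finset.single_le_sum hterm (Finset.mem_range.2 hlL)
  have hone : layerWt D L S l * (1 / 2 ^ l) ≤ layerWt D L S l *
      ((((layerNodes S l).filter fun j => growTwig S j = growTwig S m).card : ℝ) /
        (layerNodes S l).card) :=
    mul_le_mul_of_nonneg_left (div_le_div₀ (by positivity) hcard1 hcard0 hcard)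
      (layerWt_nonneg hD L S l)
  have hcoef : (1 : ℝ) / 2 ≤ if (twigPruneCands S).Nonempty then (1 : ℝ) / 2 else 1 := by
    split_ifs <;> norm_num
  unfold twiggyProp
  refine (layerWt_ge hD hlL ⟨m, hml⟩).trans (le_add_of_le_of_nonneg ?_ ?_)
  · exact mul_le_mul hcoef (hone.trans hsum)
      (mul_nonneg (layerWt_nonneg hD L S l) (by positivity)) (by linarith)
  · apply mul_nonneg
    · split_ifs <;> norm_num
    · positivity

lemma twiggyProp_ge_prune {D : ℝ} (hD : 1 < D) {L : ℕ} {S : Finset ℕ} (hS : IsTree L S) {j : ℕ}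
    (hj : j ∈ twigPruneCands S) :
    (invRate D L)⁻¹ ≤ twiggyProp L D S (pruneTwig S j) := by
  have hcard0 : (0 : ℝ) < (twigPruneCands S).card := by
    exact_mod_cast Finset.card_pos.2 ⟨j, hj⟩
  have hcard1 := one_le_card_filter_eq (pruneTwig S) hj
  have hle : (twigPruneCands S).card ≤ 2 ^ L - 1 := by
    have hsub : twigPruneCands S ⊆ (Finset.range (2 ^ L)).erase 0 := by
      intro k hk
      simp only [twigPruneCands, Finset.mem_filter] at hk
      exact Finset.mem_erase.2 ⟨hk.2.1, Finset.mem_range.2 (hS.2.2 k hk.1)⟩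
    refine (Finset.card_le_card hsub).trans ?_
    rw [Finset.card_erase_of_mem (Finset.mem_range.2 (by positivity)), Finset.card_range]
  have hrate : 2 * ((twigPruneCands S).card : ℝ) ≤ invRate D L := by
    unfold invRate
    rcases L with _ | _ | L
    · have : 0 < (twigPruneCands S).card := Finset.card_pos.2 ⟨j, hj⟩
      simp at hle
      simp [hle] at this
    · norm_num
      exact_mod_cast hle
    · have h1 : ((twigPruneCands S).card : ℝ) ≤ 2 ^ (L + 1 + 1) := by
        exact_mod_cast hle.trans (Nat.sub_le _ _)
      have h2 : 2 ≤ ∑ l ∈ Finset.range (L + 1 + 1), D ^ l := by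
        rw [Finset.sum_range_succ', Finset.sum_range_succ']
        have : 0 ≤ ∑ k ∈ Finset.range L, D ^ (k + 1 + 1) :=
          Finset.sum_nonneg fun _ _ => by positivity
        simp only [zero_add, pow_one, pow_zero]
        linarith
      have : (0 : ℝ) < 2 ^ (L + 1 + 1) := by positivity
      nlinarith
  have hbase : (invRate D L)⁻¹ ≤ 1 / 2 * (1 / (twigPruneCands S).card) := by
    rw [one_div_mul_one_div, ← one_div]
    exact one_div_le_one_div_of_le (by positivity) hrate
  unfold twiggyProp
  refine hbase.trans (le_add_of_nonneg_of_le ?_ ?_)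
  · apply mul_nonneg
    · split_ifs <;> norm_num
    · exact Finset.sum_nonneg fun l _ => mul_nonneg (layerWt_nonneg hD L S l) (by positivity)
  · have hcoef : (1 : ℝ) / 2 ≤
        if ∃ l ∈ Finset.range L, (layerNodes S l).Nonempty then (1 : ℝ) / 2 else 1 := by
      split_ifs <;> norm_num
    exact mul_le_mul hcoef (div_le_div_of_nonneg_right hcard1 hcard0.le) (by positivity)
      (by linarith)

/-! ## The canonical transition map -/

lemma gTwig_cases {L : ℕ} {Sstar S : Finset ℕ} (hstar : IsTree L Sstar) :
    gTwig Sstar S = S ∨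
    (∃ j ∈ twigPruneCands S, j ∉ Sstar ∧ gTwig Sstar S = pruneTwig S j) ∨
    (S ⊆ Sstar ∧ ∃ j ∈ Sstar \ S, (∀ k ∈ Sstar \ S, k ≤ j) ∧
      gTwig Sstar S = growTwig S j) := by
  unfold gTwig
  split_ifs with heq
  · exact Or.inl rfl
  split
  · next j hj =>
    have hmem := Finset.mem_of_min hj
    rw [Finset.mem_filter, Finset.mem_sdiff] at hmem
    refine Or.inr (Or.inl ⟨j, Finset.mem_filter.2 ⟨hmem.1.1, ?_, hmem.2⟩, hmem.1.2, rfl⟩)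
    rintro rfl
    exact hmem.1.2 hstar.1
  · next hnone =>
    have hsub : S ⊆ Sstar := by
      rw [← Finset.sdiff_eq_empty_iff_subset]
      by_contra hne
      have hne' := Finset.nonempty_iff_ne_empty.2 hne
      have hmem := Finset.max'_mem _ hne'
      have hfil : (S \ Sstar).max' hne' ∈ (S \ Sstar).filter fun j =>
          ∀ a ∈ descIn S j, ∀ b ∈ descIn S j, a = b ∨ isAnc a b ∨ isAnc b a := by
        refine Finset.mem_filter.2 ⟨hmem, fun a ha => ?_⟩
        rw [descIn, Finset.mem_filter] at ha
        have hastar : a ∉ Sstar := fun h =>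
          (Finset.mem_sdiff.1 hmem).2 (hstar.mem_of_isAnc h ha.2)
        have hle := Finset.le_max' _ a (Finset.mem_sdiff.2 ⟨ha.1, hastar⟩)
        have := ha.2.lt
        omega
      have := Finset.min_eq_top.1 hnone
      rw [this] at hfil
      simp at hfil
    split
    · next j hj =>
      exact Or.inr (Or.inr ⟨hsub, j, Finset.mem_of_max hj, fun k hk =>
        Finset.le_max_of_eq hk hj, rfl⟩)
    · exact Or.inl rfl

lemma growTwig_subset {L : ℕ} {Sstar S : Finset ℕ} (hstar : IsTree L Sstar) (hsub : S ⊆ Sstar)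
    {j : ℕ} (hj : j ∈ Sstar) : growTwig S j ⊆ Sstar :=
  Finset.union_subset hsub (hstar.ancPath_subset hj)

/-- A node of `𝒯*` all of whose descendants in `𝒯*` lie in the ancestor-closed set `S` missing
the node itself is a leaf of `𝒯*`, hence a signal by minimality. -/
lemma mem_of_max_missing {L : ℕ} {B Sstar S : Finset ℕ} (hstar : IsTree L Sstar)
    (hBstar : B ⊆ Sstar) (hmin : ∀ T ∈ trees L, B ⊆ T → Sstar ⊆ T) (hS : IsTree L S)
    {j : ℕ} (hj : j ∈ Sstar \ S) (hmax : ∀ k ∈ Sstar \ S, k ≤ j) : j ∈ B := by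
  by_contra hjB
  rw [Finset.mem_sdiff] at hj
  have hj0 : j ≠ 0 := by rintro rfl; exact hj.2 hS.1
  have htree : IsTree L (Sstar.erase j) := by
    refine ⟨Finset.mem_erase.2 ⟨hj0.symm, hstar.1⟩, fun k hk h1 => ?_, fun k hk =>
      hstar.2.2 k (Finset.mem_of_mem_erase hk)⟩
    rw [Finset.mem_erase] at hk ⊢
    refine ⟨?_, hstar.2.1 k hk.2 h1⟩
    rintro rfl
    have hkS : k ∉ S := fun h => hj.2 (hS.2.1 k h h1)
    have := hmax k (Finset.mem_sdiff.2 ⟨hk.2, hkS⟩)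
    omega
  have hsub := hmin _ (mem_trees.2 htree) fun b hb =>
    Finset.mem_erase.2 ⟨fun h => hjB (h ▸ hb), hBstar hb⟩
  exact (Finset.mem_erase.1 (hsub hj.1)).1 rfl

lemma isTree_gTwig {L : ℕ} {Sstar S : Finset ℕ} (hstar : IsTree L Sstar) (hS : IsTree L S) :
    IsTree L (gTwig Sstar S) := by
  rcases gTwig_cases hstar (S := S) with h | ⟨j, hj, -, h⟩ | ⟨-, j, hj, -, h⟩
  · rwa [h]
  · rw [h]
    exact isTree_pruneTwig hS (Finset.mem_filter.1 hj).2.1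
  · rw [h]
    exact isTree_growTwig hS (hstar.2.2 j (Finset.mem_sdiff.1 hj).1)

/-- Proposal probabilities along a canonical edge, in both directions. -/
lemma twiggyProp_ge_gTwig {D : ℝ} (hD : 1 < D) {L : ℕ} {Sstar S : Finset ℕ}
    (hstar : IsTree L Sstar) (hS : IsTree L S) (hne : gTwig Sstar S ≠ S) :
    (invRate D L)⁻¹ ≤ twiggyProp L D S (gTwig Sstar S) ∧
      (invRate D L)⁻¹ ≤ twiggyProp L D (gTwig Sstar S) S := by
  have hS' := isTree_gTwig hstar hS
  rcases gTwig_cases hstar (S := S) with h | ⟨j, hj, -, h⟩ | ⟨-, j, hj, -, h⟩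
  · exact absurd h hne
  · rw [h] at hS' ⊢
    refine ⟨twiggyProp_ge_prune hD hS hj, ?_⟩
    obtain ⟨m, hmS, hm, hgrow⟩ := exists_growTwig_pruneTwig hS hj
    have := twiggyProp_ge_grow hD hS' hm (hS.2.2 m hmS)
    rwa [hgrow] at this
  · rw [h] at hS' ⊢
    rw [Finset.mem_sdiff] at hj
    refine ⟨twiggyProp_ge_grow hD hS hj.2 (hstar.2.2 j hj.1), ?_⟩
    obtain ⟨i, hi, hprune⟩ := exists_pruneTwig_growTwig hS hj.2
    have := twiggyProp_ge_prune hD hS' hi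
    rwa [hprune] at this

/-! ## Posterior mass along canonical paths -/

/-- Multiplicative node weights for which redundant nodes are penalized and every grow step of
the canonical map toward `𝒯*` gains at least a factor `η⁻¹`. -/
structure GoodWeights (L : ℕ) (Sstar : Finset ℕ) (w : ℕ → ℝ) (η : ℝ) : Prop where
  tree : IsTree L Sstar
  pos : ∀ j, 0 < w j
  eta_pos : 0 < η
  eta_lt : η < 1
  lt_one : ∀ j < 2 ^ L, j ∉ Sstar → w j < 1
  grow : ∀ S, IsTree L S → S ⊆ Sstar → ∀ j ∈ Sstar \ S, (∀ k ∈ Sstar \ S, k ≤ j) →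
    ∏ i ∈ S, w i ≤ η * ∏ i ∈ growTwig S j, w i

namespace GoodWeights

variable {L : ℕ} {Sstar : Finset ℕ} {w : ℕ → ℝ} {η : ℝ}

lemma prod_pos (h : GoodWeights L Sstar w η) (S : Finset ℕ) : 0 < ∏ i ∈ S, w i :=
  Finset.prod_pos fun j _ => h.pos j

lemma prod_lt_gTwig (h : GoodWeights L Sstar w η) {S : Finset ℕ} (hS : IsTree L S)
    (hne : gTwig Sstar S ≠ S) : ∏ i ∈ S, w i < ∏ i ∈ gTwig Sstar S, w i := by
  rcases gTwig_cases h.tree (S := S) with h' | ⟨j, hj, hjs, h'⟩ | ⟨hsub, j, hj, hmax, h'⟩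
  · exact absurd h' hne
  · rw [h', ← Finset.prod_sdiff (pruneTwig_subset S j)]
    refine mul_lt_of_lt_one_left (h.prod_pos _) ?_
    have hjS : j ∈ S := (Finset.mem_filter.1 hj).1
    have hmem : ∀ k ∈ S \ pruneTwig S j, w k < 1 := by
      intro k hk
      rw [Finset.mem_sdiff, mem_pruneTwig] at hk
      refine h.lt_one k (hS.2.2 k hk.1) fun hks => ?_
      have : k = j ∨ isAnc j k := by tauto
      rcases this with rfl | hanc
      · exact hjs hks
      · exact hjs (h.tree.mem_of_isAnc hks hanc)
    have hjm : j ∈ S \ pruneTwig S j :=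
      Finset.mem_sdiff.2 ⟨hjS, fun hmem => (mem_pruneTwig.1 hmem).2.1 rfl⟩
    rw [← Finset.mul_prod_erase _ _ hjm]
    refine mul_lt_one_of_nonneg_of_lt_one_left (h.pos j).le (hmem j hjm) ?_
    exact Finset.prod_le_one (fun k _ => (h.pos k).le)
      fun k hk => (hmem k (Finset.mem_of_mem_erase hk)).le
  · rw [h']
    exact (h.grow S hS hsub j hj hmax).trans_lt (mul_lt_of_lt_one_left (h.prod_pos _) h.eta_lt)

lemma isTree_iterate (h : GoodWeights L Sstar w η) {T : Finset ℕ} (hT : IsTree L T) (t : ℕ) :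
    IsTree L ((gTwig Sstar)^[t] T) := by
  induction t with
  | zero => exact hT
  | succ t ih =>
    rw [Function.iterate_succ_apply']
    exact isTree_gTwig h.tree ih

/-- A state on the canonical path from `T` either still carries part of the redundant nodes of `T`,
or is a subtree of `𝒯*` obtained from `T ∩ 𝒯*` by at least one grow step. -/
lemma iterate_cases (h : GoodWeights L Sstar w η) {T : Finset ℕ} (hT : IsTree L T) (t : ℕ) :
    ((gTwig Sstar)^[t] T ⊆ T ∧ T \ (gTwig Sstar)^[t] T ⊆ Finset.range (2 ^ L) \ Sstar) ∨
    ((gTwig Sstar)^[t] T ⊆ Sstar ∧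
      ∏ i ∈ T ∩ Sstar, w i ≤ η * ∏ i ∈ (gTwig Sstar)^[t] T, w i) := by
  induction t with
  | zero => exact Or.inl ⟨subset_rfl, by simp⟩
  | succ t ih =>
    rw [Function.iterate_succ_apply']
    have hU := h.isTree_iterate hT t
    generalize (gTwig Sstar)^[t] T = U at ih hU
    rcases gTwig_cases h.tree (S := U) with h' | ⟨j, hj, hjs, h'⟩ | ⟨hsub, j, hj, hmax, h'⟩
    · rwa [h']
    · rw [h']
      rcases ih with ⟨h1, h2⟩ | ⟨h1, -⟩
      · refine Or.inl ⟨(pruneTwig_subset U j).trans h1, fun k hk => ?_⟩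
        rw [Finset.mem_sdiff] at hk
        by_cases hkU : k ∈ U
        · refine Finset.mem_sdiff.2 ⟨Finset.mem_range.2 (hU.2.2 k hkU), fun hks => ?_⟩
          have : k = j ∨ isAnc j k := by
            have := hk.2
            rw [mem_pruneTwig] at this
            tauto
          rcases this with rfl | hanc
          · exact hjs hks
          · exact hjs (h.tree.mem_of_isAnc hks hanc)
        · exact h2 (Finset.mem_sdiff.2 ⟨hk.1, hkU⟩)
      · exact absurd (h1 (Finset.mem_filter.1 hj).1) hjs
    · rw [h']
      have hgrow := h.grow U hU hsub j hj hmax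
      refine Or.inr ⟨growTwig_subset h.tree hsub (Finset.mem_sdiff.1 hj).1, ?_⟩
      rcases ih with ⟨h1, h2⟩ | ⟨-, h2⟩
      · have : T ∩ Sstar = U := by
          ext k
          rw [Finset.mem_inter]
          constructor
          · rintro ⟨hkT, hks⟩
            by_contra hkU
            exact (Finset.mem_sdiff.1 (h2 (Finset.mem_sdiff.2 ⟨hkT, hkU⟩))).2 hks
          · exact fun hk => ⟨h1 hk, hsub hk⟩
        rwa [this]
      · refine h2.trans (le_trans ?_ hgrow)
        exact mul_le_of_le_one_left (h.prod_pos _).le h.eta_lt.le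

/-- The mass of all trees whose canonical path passes through `U`, relative to that of `U`. -/
lemma sum_prod_le (h : GoodWeights L Sstar w η) {U : Finset ℕ} {F : Finset (Finset ℕ)}
    (hF : ∀ T ∈ F, IsTree L T ∧ ∃ t, (gTwig Sstar)^[t] T = U) :
    ∑ T ∈ F, ∏ i ∈ T, w i ≤ (∏ i ∈ U, w i) *
      ((∏ j ∈ Finset.range (2 ^ L) \ Sstar, (1 + w j)) * (1 + 2 ^ Sstar.card * η)) := by
  set R := Finset.range (2 ^ L) \ Sstar with hR
  set p := fun T : Finset ℕ => U ⊆ T ∧ T \ U ⊆ R with hp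
  have hW : ∀ A : Finset ℕ, 0 ≤ ∏ i ∈ A, w i := fun A => (h.prod_pos A).le
  have h1 : ∑ T ∈ F with p T, ∏ i ∈ T, w i ≤
      (∏ i ∈ U, w i) * ∏ j ∈ R, (1 + w j) := by
    have hinj : Set.InjOn (fun T : Finset ℕ => T \ U) (F.filter p : Finset (Finset ℕ)) := by
      intro T hT T' hT' heq
      have hT1 := (Finset.mem_filter.1 hT).2.1
      have hT1' := (Finset.mem_filter.1 hT').2.1
      rw [← Finset.union_sdiff_of_subset hT1, ← Finset.union_sdiff_of_subset hT1']
      exact congrArg _ heq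
    calc ∑ T ∈ F with p T, ∏ i ∈ T, w i
        = ∑ T ∈ F with p T, (∏ i ∈ U, w i) * ∏ i ∈ T \ U, w i := by
          refine Finset.sum_congr rfl fun T hT => ?_
          rw [mul_comm, Finset.prod_sdiff (Finset.mem_filter.1 hT).2.1]
      _ = (∏ i ∈ U, w i) * ∑ A ∈ (F.filter p).image (fun T => T \ U), ∏ i ∈ A, w i := by
          rw [Finset.sum_image hinj, Finset.mul_sum]
      _ ≤ (∏ i ∈ U, w i) * ∑ A ∈ R.powerset, ∏ i ∈ A, w i := by
          refine mul_le_mul_of_nonneg_left (Finset.sum_le_sum_of_subset_of_nonneg ?_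
            fun A _ _ => hW A) (hW U)
          intro A hA
          obtain ⟨T, hT, rfl⟩ := Finset.mem_image.1 hA
          exact Finset.mem_powerset.2 (Finset.mem_filter.1 hT).2.2
      _ = _ := by rw [Finset.prod_one_add]
  have h2 : ∑ T ∈ F with ¬ p T, ∏ i ∈ T, w i ≤
      (∏ i ∈ U, w i) * ((∏ j ∈ R, (1 + w j)) * (2 ^ Sstar.card * η)) := by
    have hinj : Set.InjOn (fun T : Finset ℕ => (T ∩ Sstar, T \ Sstar))
        (F.filter fun T => ¬ p T : Finset (Finset ℕ)) := by
      intro T _ T' _ heq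
      rw [Prod.mk.injEq] at heq
      rw [← Finset.sdiff_union_inter T Sstar, ← Finset.sdiff_union_inter T' Sstar, heq.1, heq.2]
    calc ∑ T ∈ F with ¬ p T, ∏ i ∈ T, w i
        ≤ ∑ T ∈ F with ¬ p T, η * (∏ i ∈ U, w i) * ∏ i ∈ T \ Sstar, w i := by
          refine Finset.sum_le_sum fun T hT => ?_
          rw [Finset.mem_filter] at hT
          obtain ⟨hTt, t, rfl⟩ := hF T hT.1
          rcases h.iterate_cases hTt t with hc | ⟨-, hc⟩
          · exact absurd hc hT.2
          · rw [← Finset.prod_inter_mul_prod_sdiff T Sstar]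
            exact mul_le_mul_of_nonneg_right hc (hW _)
      _ = ∑ x ∈ (F.filter fun T => ¬ p T).image (fun T => (T ∩ Sstar, T \ Sstar)),
            η * (∏ i ∈ U, w i) * ∏ i ∈ x.2, w i := by rw [Finset.sum_image hinj]
      _ ≤ ∑ x ∈ Sstar.powerset ×ˢ R.powerset, η * (∏ i ∈ U, w i) * ∏ i ∈ x.2, w i := by
          refine Finset.sum_le_sum_of_subset_of_nonneg ?_ fun x _ _ =>
            mul_nonneg (mul_nonneg h.eta_pos.le (hW U)) (hW _)
          intro x hx
          obtain ⟨T, hT, rfl⟩ := Finset.mem_image.1 hx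
          have hTt := (hF T (Finset.mem_filter.1 hT).1).1
          refine Finset.mem_product.2 ⟨Finset.mem_powerset.2 Finset.inter_subset_right,
            Finset.mem_powerset.2 fun k hk => ?_⟩
          rw [Finset.mem_sdiff] at hk ⊢
          exact ⟨Finset.mem_range.2 (hTt.2.2 k hk.1), hk.2⟩
      _ = _ := by
          rw [Finset.sum_product, Finset.prod_one_add]
          simp only [← Finset.mul_sum, Finset.sum_const, Finset.card_powerset, nsmul_eq_mul]
          push_cast
          ring
  calc ∑ T ∈ F, ∏ i ∈ T, w i
      = ∑ T ∈ F with p T, ∏ i ∈ T, w i + ∑ T ∈ F with ¬ p T, ∏ i ∈ T, w i :=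
        (Finset.sum_filter_add_sum_filter_not F p _).symm
    _ ≤ _ := add_le_add h1 h2
    _ = _ := by ring

end GoodWeights

/-! ## Congestion for general good weights -/

lemma IsTree.eq_singleton {S : Finset ℕ} (hS : IsTree 0 S) : S = {0} := by
  refine Finset.eq_singleton_iff_unique_mem.2 ⟨hS.1, fun j hj => ?_⟩
  simpa using hS.2.2 j hj

lemma invRate_pos {D : ℝ} (hD : 1 < D) {L : ℕ} (hL : L ≠ 0) : 0 < invRate D L := by
  unfold invRate
  have : 0 < ∑ l ∈ Finset.range L, D ^ l :=
    Finset.sum_pos (fun _ _ => by have : 0 < D := by linarith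
                                  positivity) (Finset.nonempty_range_iff.2 hL)
  positivity

/-- The ergodic flow of a lazy Metropolis–Hastings chain is bounded below by the smaller of the
two endpoint masses and a common lower bound on the proposal probabilities. -/
lemma flow_ge (L : ℕ) {μ : Finset ℕ → ℝ} {q : Finset ℕ → Finset ℕ → ℝ} {U U' : Finset ℕ}
    (hne : U ≠ U') {r : ℝ} (hr : 0 < r) (hU : 0 < μ U) (hU' : 0 < μ U') (hq : r ≤ q U U')
    (hq' : r ≤ q U' U) :
    r / 2 * min (μ U) (μ U') ≤ μ U * lazy (mhTrans L μ q) U U' := by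
  unfold lazy mhTrans
  rw [if_neg hne.symm, if_neg hne.symm, add_zero]
  have hqp : 0 < q U U' := hr.trans_le hq
  have hpos : 0 < μ U * q U U' := mul_pos hU hqp
  have : μ U * (1 / 2 * (q U U' * min 1 (μ U' * q U' U / (μ U * q U U')))) =
      1 / 2 * min (μ U * q U U') (μ U' * q U' U) := by
    have h1 : μ U * q U U' * min 1 (μ U' * q U' U / (μ U * q U U')) =
        min (μ U * q U U') (μ U' * q U' U) := by
      rw [mul_min_of_nonneg _ _ hpos.le, mul_one, mul_div_cancel₀ _ hpos.ne']
    rw [← h1]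
    ring
  rw [this, show r / 2 * min (μ U) (μ U') = 1 / 2 * (r * min (μ U) (μ U')) by ring]
  refine mul_le_mul_of_nonneg_left (le_min ?_ ?_) (by norm_num)
  · rw [mul_comm (μ U)]
    exact mul_le_mul hq (min_le_left _ _) (lt_min hU hU').le hqp.le
  · rw [mul_comm (μ U')]
    exact mul_le_mul hq' (min_le_right _ _) (lt_min hU hU').le (hr.le.trans hq')

lemma mem_pathEdges {L : ℕ} {g : Finset ℕ → Finset ℕ} {T U U' : Finset ℕ}
    (h : (U, U') ∈ pathEdges L g T) : (∃ t, g^[t] T = U) ∧ g U = U' ∧ U ≠ U' := by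
  simp only [pathEdges, Finset.mem_filter, Finset.mem_image, Prod.mk.injEq] at h
  obtain ⟨⟨t, -, rfl, rfl⟩, hne⟩ := h
  exact ⟨⟨t, rfl⟩, (Function.iterate_succ_apply' g t T).symm, hne⟩

namespace GoodWeights

variable {L : ℕ} {Sstar : Finset ℕ} {w : ℕ → ℝ} {η : ℝ}

/-- Congestion across a canonical edge `{V, 𝒢(V)}` traversed in either direction. -/
lemma edge_congestion_le (h : GoodWeights L Sstar w η) {D : ℝ} (hD : 1 < D)
    {μ : Finset ℕ → ℝ} {κ : ℝ} (hκ : 0 < κ) (hμ : ∀ T ∈ trees L, μ T = κ * ∏ i ∈ T, w i)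
    {V : Finset ℕ} (hV : V ∈ trees L) (hne : gTwig Sstar V ≠ V) {s flow : ℝ}
    {F : Finset (Finset ℕ)} (hF : ∀ T ∈ F, T ∈ trees L ∧ ∃ t, (gTwig Sstar)^[t] T = V)
    (hs : s ≤ ∑ T ∈ F, μ T)
    (hflow : (invRate D L)⁻¹ / 2 * min (μ V) (μ (gTwig Sstar V)) ≤ flow) :
    s / flow ≤ 2 * invRate D L *
      ((∏ j ∈ Finset.range (2 ^ L) \ Sstar, (1 + w j)) * (1 + 2 ^ Sstar.card * η)) := by
  set K := (∏ j ∈ Finset.range (2 ^ L) \ Sstar, (1 + w j)) * (1 + 2 ^ Sstar.card * η) with hK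
  have hVt := mem_trees.1 hV
  have hV't := isTree_gTwig h.tree hVt
  have hL : L ≠ 0 := by
    rintro rfl
    exact hne (hV't.eq_singleton.trans hVt.eq_singleton.symm)
  have hrate := invRate_pos hD hL
  have hμV : 0 < μ V := by
    rw [hμ V hV]
    exact mul_pos hκ (h.prod_pos V)
  have hlt : μ V ≤ μ (gTwig Sstar V) := by
    rw [hμ V hV, hμ _ (mem_trees.2 hV't)]
    exact mul_le_mul_of_nonneg_left (h.prod_lt_gTwig hVt hne).le hκ.le
  rw [min_eq_left hlt] at hflow
  have hs' : s ≤ μ V * K := by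
    refine hs.trans ?_
    rw [Finset.sum_congr rfl fun T hT => hμ T (hF T hT).1, ← Finset.mul_sum, hμ V hV, mul_assoc]
    exact mul_le_mul_of_nonneg_left
      (h.sum_prod_le fun T hT => ⟨mem_trees.1 (hF T hT).1, (hF T hT).2⟩) hκ.le
  have hK0 : 0 < K := mul_pos (Finset.prod_pos fun j _ => by have := h.pos j; linarith)
    (by have := h.eta_pos; positivity)
  have hbase : 0 < (invRate D L)⁻¹ / 2 * μ V := by positivity
  rw [div_le_iff₀ (hbase.trans_le hflow)]
  calc s ≤ μ V * K := hs'
    _ = 2 * invRate D L * K * ((invRate D L)⁻¹ / 2 * μ V) := by field_simp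
    _ ≤ _ := mul_le_mul_of_nonneg_left hflow (by positivity)

lemma congestion_le (h : GoodWeights L Sstar w η) {D : ℝ} (hD : 1 < D)
    {μ : Finset ℕ → ℝ} {κ : ℝ} (hκ : 0 < κ) (hμ : ∀ T ∈ trees L, μ T = κ * ∏ i ∈ T, w i)
    (hsum : ∑ T ∈ trees L, μ T = 1) {U U' : Finset ℕ} (hU : U ∈ trees L) (hU' : U' ∈ trees L)
    (hon : ∃ T ∈ trees L, ∃ T' ∈ trees L, onPath L (gTwig Sstar) (U, U') T T') :
    (∑ e ∈ (trees L ×ˢ trees L).filter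
        (fun e => onPath L (gTwig Sstar) (U, U') e.1 e.2), μ e.1 * μ e.2) /
      (μ U * lazy (mhTrans L μ (twiggyProp L D)) U U') ≤ 2 * invRate D L *
      ((∏ j ∈ Finset.range (2 ^ L) \ Sstar, (1 + w j)) * (1 + 2 ^ Sstar.card * η)) := by
  have hpos : ∀ T ∈ trees L, 0 < μ T := fun T hT => by
    rw [hμ T hT]
    exact mul_pos hκ (h.prod_pos T)
  have hone : ¬ (gTwig Sstar U = U' ∧ gTwig Sstar U' = U ∧ U ≠ U') := by
    rintro ⟨h1, h2, h3⟩
    have l1 := h.prod_lt_gTwig (mem_trees.1 hU) (by rw [h1]; exact h3.symm)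
    have l2 := h.prod_lt_gTwig (mem_trees.1 hU') (by rw [h2]; exact h3)
    rw [h1] at l1
    rw [h2] at l2
    exact lt_asymm l1 l2
  obtain ⟨T₀, -, T₁, -, hon⟩ := hon
  have hL : U ≠ U' → L ≠ 0 := by
    rintro hne rfl
    exact hne ((mem_trees.1 hU).eq_singleton.trans (mem_trees.1 hU').eq_singleton.symm)
  have hcase : (gTwig Sstar U = U' ∧ U ≠ U') ∨ (gTwig Sstar U' = U ∧ U ≠ U') := by
    rcases hon with ⟨hm, -⟩ | ⟨hm, -⟩
    · exact Or.inl (mem_pathEdges hm).2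
    · exact Or.inr ⟨(mem_pathEdges hm).2.1, (mem_pathEdges hm).2.2.symm⟩
  rcases hcase with ⟨hg, hne⟩ | ⟨hg, hne⟩
  · have hgne : gTwig Sstar U ≠ U := by rw [hg]; exact hne.symm
    obtain ⟨q1, q2⟩ := twiggyProp_ge_gTwig hD h.tree (mem_trees.1 hU) hgne
    refine h.edge_congestion_le hD hκ hμ hU hgne
      (F := (trees L).filter fun T => (U, U') ∈ pathEdges L (gTwig Sstar) T) ?_ ?_ ?_
    · intro T hT
      rw [Finset.mem_filter] at hT
      exact ⟨hT.1, (mem_pathEdges hT.2).1⟩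
    · rw [← mul_one (∑ T ∈ _, μ T), ← hsum, Finset.sum_mul_sum, ← Finset.sum_product']
      refine Finset.sum_le_sum_of_subset_of_nonneg ?_ fun e he _ => ?_
      · intro e he
        rw [Finset.mem_filter, Finset.mem_product] at he
        rw [Finset.mem_product, Finset.mem_filter]
        refine ⟨⟨he.1.1, ?_⟩, he.1.2⟩
        rcases he.2 with ⟨hm, -⟩ | ⟨hm, -⟩
        · exact hm
        · exact absurd ⟨hg, (mem_pathEdges hm).2.1, hne⟩ hone
      · rw [Finset.mem_product, Finset.mem_filter] at he
        exact (mul_pos (hpos _ he.1.1) (hpos _ he.2)).le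
    · rw [hg] at q1 q2 ⊢
      exact flow_ge L hne (inv_pos.2 (invRate_pos hD (hL hne))) (hpos U hU) (hpos U' hU') q1 q2
  · have hgne : gTwig Sstar U' ≠ U' := by rw [hg]; exact hne
    obtain ⟨q1, q2⟩ := twiggyProp_ge_gTwig hD h.tree (mem_trees.1 hU') hgne
    refine h.edge_congestion_le hD hκ hμ hU' hgne
      (F := (trees L).filter fun T => (U', U) ∈ pathEdges L (gTwig Sstar) T) ?_ ?_ ?_
    · intro T hT
      rw [Finset.mem_filter] at hT
      exact ⟨hT.1, (mem_pathEdges hT.2).1⟩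
    · rw [← one_mul (∑ T ∈ _, μ T), ← hsum, Finset.sum_mul_sum, ← Finset.sum_product']
      refine Finset.sum_le_sum_of_subset_of_nonneg ?_ fun e he _ => ?_
      · intro e he
        rw [Finset.mem_filter, Finset.mem_product] at he
        rw [Finset.mem_product, Finset.mem_filter]
        refine ⟨he.1.1, he.1.2, ?_⟩
        rcases he.2 with ⟨hm, -⟩ | ⟨hm, -⟩
        · exact absurd ⟨(mem_pathEdges hm).2.1, hg, hne⟩ hone
        · exact hm
      · rw [Finset.mem_product, Finset.mem_filter] at he
        exact (mul_pos (hpos _ he.1) (hpos _ he.2.1)).le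
    · rw [hg] at q1 q2 ⊢
      rw [min_comm]
      exact flow_ge L hne (inv_pos.2 (invRate_pos hD (hL hne))) (hpos U hU) (hpos U' hU') q2 q1

end GoodWeights

/-! ## The posterior as a product of node weights -/

/-- A tree has as many external as internal nodes. -/
lemma card_extSet {L : ℕ} {S : Finset ℕ} (hS : IsTree L S) : (extSet S).card = S.card := by
  unfold extSet
  set U := (S.image fun j => 2 * j) ∪ S.image fun j => 2 * j + 1 with hU
  have hUcard : U.card = S.card + S.card := by
    rw [hU, Finset.card_union_of_disjoint, Finset.card_image_of_injective,
      Finset.card_image_of_injective]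
    · intro a b hab
      simpa using hab
    · intro a b hab
      simpa using hab
    · rw [Finset.disjoint_left]
      intro x hx hx'
      obtain ⟨a, -, rfl⟩ := Finset.mem_image.1 hx
      obtain ⟨b, -, hb⟩ := Finset.mem_image.1 hx'
      omega
  have hSU : S ⊆ U := by
    intro k hk
    have hhalf : k / 2 ∈ S := by
      rcases Nat.eq_zero_or_pos k with rfl | h
      · exact hS.1
      · exact hS.2.1 k hk h
    rcases Nat.even_or_odd' k with ⟨m, hm | hm⟩
    · exact Finset.mem_union_left _ (Finset.mem_image.2 ⟨k / 2, hhalf, by omega⟩)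
    · exact Finset.mem_union_right _ (Finset.mem_image.2 ⟨k / 2, hhalf, by omega⟩)
  have : (U.filter fun j => j ∉ S) = U \ S := by
    ext; simp
  rw [this, Finset.card_sdiff_of_subset hSU, hUcard, Nat.add_sub_cancel]

/-- The factor contributed by the internal node `j` to the posterior weight of a tree. -/
def nodeWt (n : ℕ) (p : ℝ) (Y : Fin n → ℝ) (j : ℕ) : ℝ :=
  p * (1 - p) * (1 + n : ℝ) ^ (-(1 / 2) : ℝ) * Real.exp (colDot n Y j ^ 2 / (2 * (n + 1)))

lemma postWt_eq (n : ℕ) (p : ℝ) (Y : Fin n → ℝ) {L : ℕ} {S : Finset ℕ} (hS : S ∈ trees L) :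
    postWt n p Y S = (2 * π) ^ (-(n : ℝ) / 2) * Real.exp (-(1 / 2) * ∑ i, Y i ^ 2) *
      ∏ j ∈ S, nodeWt n p Y j := by
  unfold postWt priorWt margLik nodeWt
  rw [card_extSet (mem_trees.1 hS), Finset.prod_mul_distrib, Finset.prod_const, ← Real.exp_sum,
    mul_pow, mul_pow, ← Real.rpow_natCast ((1 + n : ℝ) ^ (-(1 / 2) : ℝ)),
    ← Real.rpow_mul (by positivity), ← Finset.sum_div]
  have h1 : -(1 / 2) * (∑ i, Y i ^ 2 - 1 / ((n : ℝ) + 1) * ∑ j ∈ S, colDot n Y j ^ 2) =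
      -(1 / 2) * ∑ i, Y i ^ 2 + (∑ j ∈ S, colDot n Y j ^ 2) / (2 * (n + 1)) := by
    field_simp
    ring
  have h2 : -(S.card : ℝ) / 2 = -(1 / 2) * (S.card : ℝ) := by ring
  rw [h1, Real.exp_add, h2]
  ring

lemma trees_nonempty (L : ℕ) : (trees L).Nonempty := by
  refine ⟨{0}, mem_trees.2 ⟨by simp, fun j hj h1 => ?_, fun j hj => ?_⟩⟩
  · rw [Finset.mem_singleton] at hj
    omega
  · rw [Finset.mem_singleton] at hj
    subst hj
    positivity

lemma post_eq_and_sum (L n : ℕ) {p : ℝ} {Y : Fin n → ℝ} (hpos : ∀ j, 0 < nodeWt n p Y j) :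
    (∃ κ : ℝ, 0 < κ ∧ ∀ T ∈ trees L, post L n p Y T = κ * ∏ i ∈ T, nodeWt n p Y i) ∧
      ∑ T ∈ trees L, post L n p Y T = 1 := by
  have hK : 0 < (2 * π) ^ (-(n : ℝ) / 2) * Real.exp (-(1 / 2) * ∑ i, Y i ^ 2) := by
    have := Real.pi_pos
    positivity
  have hZ : 0 < ∑ T ∈ trees L, postWt n p Y T := by
    refine Finset.sum_pos (fun T hT => ?_) (trees_nonempty L)
    rw [postWt_eq n p Y hT]
    exact mul_pos hK (Finset.prod_pos fun j _ => hpos j)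
  refine ⟨⟨_, div_pos hK hZ, fun T hT => ?_⟩, ?_⟩
  · unfold post
    rw [postWt_eq n p Y hT]
    ring
  · unfold post
    rw [← Finset.sum_div, div_self hZ.ne']

/-! ## Bounds on the node weights -/

lemma rpow_eq_exp_mul_log {n : ℕ} (hn : 2 ≤ n) (x : ℝ) :
    (n : ℝ) ^ x = Real.exp (x * Real.log n) := by
  rw [Real.rpow_def_of_pos (by positivity), mul_comm]

lemma splitP_bounds {n : ℕ} (hn : 2 ≤ n) {c : ℝ} (hc : 1 < c) :
    0 < splitP n c ∧ splitP n c ≤ 1 / 2 := by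
  have hn2 : (2 : ℝ) ≤ n := by exact_mod_cast hn
  unfold splitP
  refine ⟨by positivity, ?_⟩
  calc (n : ℝ) ^ (-c) ≤ (n : ℝ) ^ (-1 : ℝ) :=
        Real.rpow_le_rpow_of_exponent_le (by linarith) (by linarith)
    _ = 1 / n := by rw [Real.rpow_neg_one, one_div]
    _ ≤ 1 / 2 := one_div_le_one_div_of_le (by norm_num) hn2

lemma nodeWt_pos {n : ℕ} (hn : 2 ≤ n) {c : ℝ} (hc : 1 < c) (Y : Fin n → ℝ) (j : ℕ) :
    0 < nodeWt n (splitP n c) Y j := by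
  obtain ⟨h1, h2⟩ := splitP_bounds hn hc
  have : 0 < 1 - splitP n c := by linarith
  unfold nodeWt
  positivity

lemma nodeWt_le {n : ℕ} (hn : 2 ≤ n) {c : ℝ} (hc : 1 < c) {Y : Fin n → ℝ} {j : ℕ}
    (hY : colDot n Y j ^ 2 ≤ 4 * n * Real.log n) :
    nodeWt n (splitP n c) Y j ≤ (n : ℝ) ^ (3 / 2 - c) := by
  obtain ⟨h1, h2⟩ := splitP_bounds hn hc
  have hn2 : (2 : ℝ) ≤ n := by exact_mod_cast hn
  have hlog : 0 ≤ Real.log n := Real.log_nonneg (by linarith)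
  have hexp : Real.exp (colDot n Y j ^ 2 / (2 * (n + 1))) ≤ (n : ℝ) ^ (2 : ℝ) := by
    rw [rpow_eq_exp_mul_log hn, Real.exp_le_exp, div_le_iff₀ (by positivity)]
    nlinarith
  have hroot : (1 + n : ℝ) ^ (-(1 / 2) : ℝ) ≤ (n : ℝ) ^ (-(1 / 2) : ℝ) :=
    Real.rpow_le_rpow_of_nonpos (by linarith) (by linarith) (by norm_num)
  unfold nodeWt
  calc splitP n c * (1 - splitP n c) * (1 + n : ℝ) ^ (-(1 / 2) : ℝ) *
        Real.exp (colDot n Y j ^ 2 / (2 * (n + 1)))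
      ≤ splitP n c * 1 * (n : ℝ) ^ (-(1 / 2) : ℝ) * (n : ℝ) ^ (2 : ℝ) := by
        gcongr
        linarith
    _ = (n : ℝ) ^ (3 / 2 - c) := by
        unfold splitP
        rw [mul_one, ← Real.rpow_add (by linarith), ← Real.rpow_add (by linarith)]
        congr 1
        ring

lemma nodeWt_ge {n : ℕ} (hn : 2 ≤ n) {c : ℝ} (hc : 1 < c) {Y : Fin n → ℝ} {j : ℕ} {b : ℝ}
    (hY : b ≤ colDot n Y j ^ 2 / (2 * (n + 1))) :
    Real.exp (-(c + 2) * Real.log n) * Real.exp b ≤ nodeWt n (splitP n c) Y j := by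
  obtain ⟨h1, h2⟩ := splitP_bounds hn hc
  have hn2 : (2 : ℝ) ≤ n := by exact_mod_cast hn
  have hinv : (n : ℝ)⁻¹ ≤ 1 - splitP n c := by
    have : (n : ℝ)⁻¹ ≤ 2⁻¹ := inv_anti₀ (by norm_num) hn2
    linarith
  have hroot : (n : ℝ)⁻¹ ≤ (1 + n : ℝ) ^ (-(1 / 2) : ℝ) := by
    have : (n : ℝ)⁻¹ = ((n : ℝ) ^ (2 : ℝ)) ^ (-(1 / 2) : ℝ) := by
      rw [← Real.rpow_mul (by linarith), ← Real.rpow_neg_one]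
      norm_num
    rw [this]
    refine Real.rpow_le_rpow_of_nonpos (by positivity) ?_ (by norm_num)
    rw [Real.rpow_two]
    nlinarith
  have hsplit : Real.exp (-(c + 2) * Real.log n) = splitP n c * (n : ℝ)⁻¹ * (n : ℝ)⁻¹ := by
    unfold splitP
    rw [← rpow_eq_exp_mul_log hn, ← Real.rpow_neg_one, ← Real.rpow_add (by linarith),
      ← Real.rpow_add (by linarith)]
    congr 1
    ring
  rw [hsplit]
  unfold nodeWt
  have hinv0 : 0 ≤ (n : ℝ)⁻¹ := by positivity
  have := hinv0.trans hinv
  gcongr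

/-- A coefficient above the detection threshold dominates the noise. -/
lemma signal_sq_ge {n : ℕ} (hn : 2 ≤ n) (hlog : 1 ≤ Real.log n) {A b z : ℝ} (hA : 4 ≤ A)
    (hb : A * Real.log n / Real.sqrt n < |b|) (hz : z ^ 2 ≤ 4 * n * Real.log n) :
    A ^ 2 / 16 * Real.log n ^ 2 ≤ (n * b + z) ^ 2 / (2 * (n + 1)) := by
  have hn2 : (2 : ℝ) ≤ n := by exact_mod_cast hn
  set ℓ := Real.log n with hℓ
  set s := Real.sqrt n with hs
  have hs0 : 0 < s := Real.sqrt_pos.2 (by linarith)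
  have hss : s * s = n := Real.mul_self_sqrt (by linarith)
  have hnb : A * s * ℓ ≤ |n * b| := by
    rw [abs_mul, abs_of_nonneg (by linarith : (0 : ℝ) ≤ n)]
    rw [div_lt_iff₀ hs0] at hb
    calc A * s * ℓ = s * (A * ℓ) := by ring
      _ ≤ s * (|b| * s) := mul_le_mul_of_nonneg_left hb.le hs0.le
      _ = n * |b| := by rw [← hss]; ring
  have hzabs : |z| ≤ A / 2 * s * ℓ := by
    have h0 : 0 ≤ A / 2 * s * ℓ := by positivity
    refine abs_le_of_sq_le_sq ?_ h0
    have h1 : (A / 2 * s * ℓ) ^ 2 = (A / 2) ^ 2 * n * (ℓ * ℓ) := by rw [← hss]; ring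
    rw [h1]
    have h2 : 4 ≤ (A / 2) ^ 2 := by nlinarith
    calc z ^ 2 ≤ 4 * n * ℓ := hz
      _ ≤ (A / 2) ^ 2 * n * (ℓ * ℓ) := by
        refine mul_le_mul (mul_le_mul_of_nonneg_right h2 (by linarith)) ?_ (by linarith)
          (by positivity)
        nlinarith
  have habs : A / 2 * s * ℓ ≤ |n * b + z| := by
    have := abs_sub_abs_le_abs_add (n * b) z
    linarith
  have hsq : (A / 2 * s * ℓ) ^ 2 ≤ (n * b + z) ^ 2 := by
    rw [← sq_abs (n * b + z)]
    exact pow_le_pow_left₀ (by positivity) habs 2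
  rw [le_div_iff₀ (by positivity)]
  refine le_trans ?_ hsq
  have h1 : (A / 2 * s * ℓ) ^ 2 = A ^ 2 / 16 * ℓ ^ 2 * (4 * n) := by rw [← hss]; ring
  rw [h1]
  exact mul_le_mul_of_nonneg_left (by linarith) (by positivity)

lemma pow_mul_le_prod {w : ℕ → ℝ} {a b : ℝ} (ha : 0 < a) (ha1 : a ≤ 1) (hb : 0 ≤ b)
    (hw : ∀ i, a ≤ w i) {A : Finset ℕ} {j k : ℕ} (hj : j ∈ A) (hwj : a * b ≤ w j)
    (hk : A.card ≤ k) : a ^ k * b ≤ ∏ i ∈ A, w i := by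
  have h1 : a ^ (A.erase j).card ≤ ∏ i ∈ A.erase j, w i := by
    rw [← Finset.prod_const]
    exact Finset.prod_le_prod (fun _ _ => ha.le) fun i _ => hw i
  rw [← Finset.mul_prod_erase _ _ hj]
  calc a ^ k * b ≤ a ^ A.card * b :=
        mul_le_mul_of_nonneg_right (pow_le_pow_of_le_one ha.le ha1 hk) hb
    _ = a * b * a ^ (A.erase j).card := by
        rw [← Finset.card_erase_add_one hj, pow_succ]
        ring
    _ ≤ _ := mul_le_mul hwj h1 (by positivity) ((mul_nonneg ha.le hb).trans hwj)

/-- On the event that the noise is uniformly small, the node weights are good. -/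
lemma goodWeights {L n : ℕ} (hn : 2 ≤ n) (hlog : 1 ≤ Real.log n)
    (hL : (L : ℝ) + 1 ≤ 2 * Real.log n) {c C₀ A C : ℝ} (hc : 5 / 2 < c) (hC₀ : 0 < C₀)
    (hA4 : 4 ≤ A) (hA : C₀ + 1 + 2 * (c + 2) ≤ A ^ 2 / 16) {β : ℕ → ℝ} {B Sstar : Finset ℕ}
    (h : Assumption1 L n A C β B Sstar) {Y : Fin n → ℝ}
    (hY : ∀ j < 2 ^ L, (colDot n Y j - n * β j) ^ 2 ≤ 4 * n * Real.log n) :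
    GoodWeights L Sstar (nodeWt n (splitP n c) Y) (Real.exp (-(C₀ + 1) * Real.log n ^ 2)) where
  tree := mem_trees.1 h.Sstar_tree
  pos := nodeWt_pos hn (by linarith) Y
  eta_pos := Real.exp_pos _
  eta_lt := by
    rw [Real.exp_lt_one_iff]
    nlinarith
  lt_one j hj hjs := by
    have hβ : β j = 0 := h.support j fun hjB => hjs (h.Sstar_contains hjB)
    have := hY j hj
    rw [hβ, mul_zero, sub_zero] at this
    refine (nodeWt_le hn (by linarith) this).trans_lt ?_
    exact Real.rpow_lt_one_of_one_lt_of_neg (by exact_mod_cast hn) (by linarith)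
  grow S hS hsub j hj hmax := by
    have hpos := nodeWt_pos hn (by linarith : 1 < c) Y
    have htree := mem_trees.1 h.Sstar_tree
    have hjB := mem_of_max_missing htree h.Sstar_contains h.Sstar_min hS hj hmax
    rw [Finset.mem_sdiff] at hj
    have hjL := h.B_depth j hjB
    set ℓ := Real.log n with hℓ
    set a := Real.exp (-(c + 2) * ℓ) with ha
    have hsig := signal_sq_ge hn hlog hA4 (h.signal_low j hjB) (hY j hjL)
    rw [add_sub_cancel] at hsig
    have hwj := nodeWt_ge hn (by linarith : 1 < c) hsig
    have hwi : ∀ i, a ≤ nodeWt n (splitP n c) Y i := by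
      intro i
      have h0 : (0 : ℝ) ≤ colDot n Y i ^ 2 / (2 * (n + 1)) := by positivity
      have := nodeWt_ge hn (by linarith : 1 < c) h0
      rwa [Real.exp_zero, mul_one] at this
    have ha1 : a ≤ 1 := by
      rw [ha, Real.exp_le_one_iff]
      nlinarith
    have hcard : (growTwig S j \ S).card ≤ L + 1 := by
      refine (Finset.card_le_card ?_).trans (ancPath_card_le hjL)
      intro k hk
      rw [Finset.mem_sdiff, growTwig, Finset.mem_union] at hk
      exact hk.1.resolve_left hk.2
    have hjm : j ∈ growTwig S j \ S :=
      Finset.mem_sdiff.2 ⟨Finset.mem_union_right _ (self_mem_ancPath j), hj.2⟩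
    have hprod := pow_mul_le_prod (Real.exp_pos _) ha1 (Real.exp_pos _).le hwi hjm hwj hcard
    have hexp : Real.exp ((C₀ + 1) * ℓ ^ 2) ≤ a ^ (L + 1) * Real.exp (A ^ 2 / 16 * ℓ ^ 2) := by
      rw [ha, ← Real.exp_nat_mul, ← Real.exp_add, Real.exp_le_exp]
      push_cast
      have h1 : ((L : ℝ) + 1) * ((c + 2) * ℓ) ≤ 2 * ℓ * ((c + 2) * ℓ) :=
        mul_le_mul_of_nonneg_right hL (by nlinarith)
      have h2 : (C₀ + 1 + 2 * (c + 2)) * ℓ ^ 2 ≤ A ^ 2 / 16 * ℓ ^ 2 :=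
        mul_le_mul_of_nonneg_right hA (by positivity)
      nlinarith
    have hge := hexp.trans hprod
    have hsubg : S ⊆ growTwig S j := Finset.subset_union_left
    rw [← Finset.prod_sdiff hsubg, ← mul_assoc]
    refine le_mul_of_one_le_left (Finset.prod_pos fun i _ => hpos i).le ?_
    calc (1 : ℝ) = Real.exp (-(C₀ + 1) * ℓ ^ 2) * Real.exp ((C₀ + 1) * ℓ ^ 2) := by
          rw [← Real.exp_add, neg_mul, neg_add_cancel, Real.exp_zero]
      _ ≤ _ := mul_le_mul_of_nonneg_left hge (Real.exp_pos _).le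

lemma prod_one_add_nodeWt_le {L n : ℕ} (hn : 2 ≤ n) (hL : 2 ^ L ≤ n) {c A C : ℝ} (hc : 1 < c)
    {β : ℕ → ℝ} {B Sstar : Finset ℕ} (h : Assumption1 L n A C β B Sstar) {Y : Fin n → ℝ}
    (hY : ∀ j < 2 ^ L, (colDot n Y j - n * β j) ^ 2 ≤ 4 * n * Real.log n) :
    ∏ j ∈ Finset.range (2 ^ L) \ Sstar, (1 + nodeWt n (splitP n c) Y j) ≤
      Real.exp ((n : ℝ) ^ (5 / 2 - c)) := by
  have hn0 : (0 : ℝ) < n := by positivity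
  calc ∏ j ∈ Finset.range (2 ^ L) \ Sstar, (1 + nodeWt n (splitP n c) Y j)
      ≤ ∏ j ∈ Finset.range (2 ^ L) \ Sstar, Real.exp ((n : ℝ) ^ (3 / 2 - c)) := by
        refine Finset.prod_le_prod (fun j _ => by have := nodeWt_pos hn hc Y j; linarith) ?_
        intro j hj
        rw [Finset.mem_sdiff, Finset.mem_range] at hj
        have hβ : β j = 0 := h.support j fun hjB => hj.2 (h.Sstar_contains hjB)
        have hYj := hY j hj.1
        rw [hβ, mul_zero, sub_zero] at hYj
        have h1 := nodeWt_le hn hc hYj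
        have h2 := Real.add_one_le_exp ((n : ℝ) ^ (3 / 2 - c))
        linarith
    _ = Real.exp ((Finset.range (2 ^ L) \ Sstar).card * (n : ℝ) ^ (3 / 2 - c)) := by
        rw [Finset.prod_const, Real.exp_nat_mul]
    _ ≤ Real.exp (n * (n : ℝ) ^ (3 / 2 - c)) := by
        rw [Real.exp_le_exp]
        refine mul_le_mul_of_nonneg_right ?_ (by positivity)
        have : (Finset.range (2 ^ L) \ Sstar).card ≤ n :=
          (Finset.card_le_card Finset.sdiff_subset).trans (by simpa using hL)
        exact_mod_cast this
    _ = Real.exp ((n : ℝ) ^ (5 / 2 - c)) := by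
        rw [show (5 / 2 - c : ℝ) = 1 + (3 / 2 - c) by ring, Real.rpow_add hn0, Real.rpow_one]

lemma two_pow_card_mul_le {n k : ℕ} (hn : 2 ≤ n) (hlog : 1 ≤ Real.log n) {C₀ : ℝ}
    (hk : (k : ℝ) ≤ C₀ * Real.log n ^ 2) :
    (2 : ℝ) ^ k * Real.exp (-(C₀ + 1) * Real.log n ^ 2) ≤ 1 / n := by
  have h2 : (2 : ℝ) ≤ Real.exp 1 := by
    have := Real.add_one_le_exp (1 : ℝ)
    linarith
  have hn0 : (0 : ℝ) < n := by positivity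
  calc (2 : ℝ) ^ k * Real.exp (-(C₀ + 1) * Real.log n ^ 2)
      ≤ Real.exp 1 ^ k * Real.exp (-(C₀ + 1) * Real.log n ^ 2) := by gcongr
    _ = Real.exp (k - (C₀ + 1) * Real.log n ^ 2) := by
        rw [← Real.exp_nat_mul, mul_one, ← Real.exp_add]
        ring_nf
    _ ≤ Real.exp (-Real.log n) := by
        rw [Real.exp_le_exp]
        nlinarith
    _ = 1 / n := by rw [Real.exp_neg, Real.exp_log hn0, one_div]

lemma eventually_bound {c δ : ℝ} (hc : 5 / 2 < c) (hδ : 0 < δ) :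
    ∃ N : ℕ, ∀ n : ℕ, N ≤ n → Real.exp ((n : ℝ) ^ (5 / 2 - c)) * (1 + 1 / n) ≤ 1 + δ := by
  have h1 : Filter.Tendsto (fun n : ℕ => (n : ℝ) ^ (5 / 2 - c)) Filter.atTop (nhds 0) := by
    have := (tendsto_rpow_neg_atTop (by linarith : 0 < c - 5 / 2)).comp
      (tendsto_natCast_atTop_atTop (R := ℝ))
    simpa [Function.comp_def] using this
  have h2 : Filter.Tendsto (fun n : ℕ => Real.exp ((n : ℝ) ^ (5 / 2 - c)) * (1 + 1 / (n : ℝ)))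
      Filter.atTop (nhds (Real.exp 0 * (1 + 0))) :=
    ((Real.continuous_exp.tendsto 0).comp h1).mul
      (tendsto_const_nhds.add tendsto_one_div_atTop_nhds_zero_nat)
  rw [Real.exp_zero, add_zero, one_mul] at h2
  exact Filter.eventually_atTop.1 ((h2.eventually_lt_const (by linarith)).mono fun _ h => h.le)

/-- With probability at least `1 - 4/n`, all noise coefficients at depth below `L ≤ M` are at most
`2 √(n log n)` in magnitude. -/
lemma gauss_noise_event {L M n : ℕ} (hn : n = 2 ^ (M + 1)) (hLM : L ≤ M)
    {S : Set (Fin n → ℝ)}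
    (hS : ∀ ε : Fin n → ℝ, (∀ j < 2 ^ L, colDot n ε j ^ 2 ≤ 4 * n * Real.log n) → ε ∈ S) :
    ENNReal.ofReal (1 - 4 / n) ≤ gauss n S := by
  have hn1 : (1 : ℝ) ≤ n := by
    rw [hn]
    exact_mod_cast Nat.one_le_two_pow
  have hn0 : (0 : ℝ) < n := by linarith
  have hlog : 0 ≤ Real.log n := Real.log_nonneg hn1
  set t := Real.sqrt (4 * n * Real.log n) with ht
  have htt : t ^ 2 = 4 * n * Real.log n := Real.sq_sqrt (by positivity)
  have htail := gauss_max_tail n (Finset.range (2 ^ L)) (fun j i => haarCol n j i.val)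
    (v := n) (t := t) (S := S) (fun j hj => by
      subst hn
      rw [sum_haarCol_fin_sq hLM (Finset.mem_range.1 hj)]
      push_cast
      rfl) (Real.sqrt_nonneg _) (fun ε hε => hS ε fun j hj => by
        rw [← htt, ← sq_abs (colDot n ε j)]
        exact pow_le_pow_left₀ (abs_nonneg _) (hε j (Finset.mem_range.2 hj)) 2)
  have hexp : Real.exp (-t ^ 2 / (2 * n)) = 1 / (n : ℝ) ^ 2 := by
    have : -t ^ 2 / (2 * n) = -(2 * Real.log n) := by
      rw [htt]
      field_simp
      ring
    rw [this, Real.exp_neg, two_mul, Real.exp_add, Real.exp_log hn0, one_div, sq]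
  have hcard : 2 * (2 : ℝ) ^ L ≤ n := by
    rw [hn]
    push_cast
    rw [← pow_succ']
    exact pow_le_pow_right₀ (by norm_num) (by omega)
  rw [hexp, Finset.card_range] at htail
  refine ENNReal.ofReal_le_of_le_toReal (le_trans ?_ htail)
  have : ((2 ^ L : ℕ) : ℝ) * (2 * (1 / (n : ℝ) ^ 2)) ≤ 4 / n := by
    push_cast
    rw [show (2 : ℝ) ^ L * (2 * (1 / (n : ℝ) ^ 2)) = 2 * 2 ^ L / n ^ 2 by ring,
      div_le_div_iff₀ (by positivity) hn0]
    nlinarith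
  linarith

/-- **Lemma (Congestion bound for the Twiggy canonical path ensemble).**
Assume the model and the Bayesian CART prior with `p_{lk} = n^{-c}`,
`c > 5/2 + log D`, and Assumption 1(b) with `|𝒯*_int| ≤ C₀ log²n` and sufficiently
large `A`.  For every `δ > 0` there is an `N` such that for all `n ≥ N`, with
probability at least `1 − 4/n` over `ε ~ N(0, I_n)`, the congestion parameter of the
Twiggy canonical path ensemble for the Twiggy Bayesian CART chain (with `D > 1`)
satisfies `ρ(𝓔) ≤ ((D^L − 1)/(D − 1)) · 2^{L+1} · (1 + δ)`. -/
theorem twiggy_congestion_bound (D : ℝ) (hD : 1 < D) (c : ℝ)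
    (hc : 5 / 2 + Real.log D < c) (C₀ : ℝ) (hC₀ : 0 < C₀) (δ : ℝ) (hδ : 0 < δ) :
    ∃ (A₀ : ℝ) (N : ℕ), 0 < A₀ ∧
      ∀ (Lmax L n : ℕ), n = 2 ^ (Lmax + 1) → L ≤ Lmax → N ≤ n →
      ∀ A ≥ A₀, ∀ (C : ℝ) (β : ℕ → ℝ) (B Sstar : Finset ℕ),
      Assumption1 L n A C β B Sstar → ¬ IsTree L B →
      (Sstar.card : ℝ) ≤ C₀ * Real.log n ^ 2 →
      ENNReal.ofReal (1 - 4 / n) ≤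
        gauss n {ε |
          ∀ U ∈ trees L, ∀ U' ∈ trees L,
            (∃ T ∈ trees L, ∃ T' ∈ trees L, onPath L (gTwig Sstar) (U, U') T T') →
            (∑ e ∈ (trees L ×ˢ trees L).filter
                  (fun e => onPath L (gTwig Sstar) (U, U') e.1 e.2),
                post L n (splitP n c) (Yvec n β B ε) e.1 *
                  post L n (splitP n c) (Yvec n β B ε) e.2) /
                (post L n (splitP n c) (Yvec n β B ε) U *
                  lazy (twiggyP L n c D (Yvec n β B ε)) U U')
              ≤ (D ^ L - 1) / (D - 1) * 2 ^ (L + 1) * (1 + δ)} := by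
  have hlogD : 0 < Real.log D := Real.log_pos hD
  have hc' : 5 / 2 < c := by linarith
  obtain ⟨N₁, hN₁⟩ := eventually_bound hc' hδ
  refine ⟨16 * (C₀ + 1 + 2 * (c + 2)), max N₁ 3, by linarith, ?_⟩
  intro M L n hn hLM hN A hA C β B Sstar h _ hcard
  have hn3 : (3 : ℝ) ≤ n := by exact_mod_cast (le_max_right _ _).trans hN
  have hn2 : 2 ≤ n := le_trans (by norm_num) ((le_max_right N₁ 3).trans hN)
  have hlog : 1 ≤ Real.log n := by
    rw [Real.le_log_iff_exp_le (by linarith)]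
    linarith [Real.exp_one_lt_d9]
  have hlogn : Real.log n = (M + 1) * Real.log 2 := by
    rw [hn]
    push_cast
    rw [← Real.rpow_natCast, Real.log_rpow (by norm_num)]
    push_cast
    rfl
  have hL : (L : ℝ) + 1 ≤ 2 * Real.log n := by
    have hLM' : (L : ℝ) ≤ M := by exact_mod_cast hLM
    rw [hlogn]
    nlinarith [Real.log_two_gt_d9]
  have hLn : 2 ^ L ≤ n := by
    rw [hn]
    exact Nat.pow_le_pow_right (by norm_num) (by omega)
  have hA16 : 16 ≤ A := by linarith
  refine gauss_noise_event hn hLM fun ε hε => ?_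
  have hY : ∀ j < 2 ^ L, (colDot n (Yvec n β B ε) j - n * β j) ^ 2 ≤ 4 * n * Real.log n := by
    intro j hj
    have hcol : colDot n (Yvec n β B ε) j - n * β j = colDot n ε j := by
      subst hn
      rw [colDot_Yvec hLM h.B_depth h.support ε hj]
      push_cast
      ring
    rw [hcol]
    exact hε j hj
  have hG := goodWeights hn2 hlog hL hc' hC₀ (by linarith) (by nlinarith) h hY
  obtain ⟨⟨κ, hκ, hμ⟩, hsum⟩ := post_eq_and_sum L n hG.pos
  intro U hU U' hU' hon
  refine (hG.congestion_le hD hκ hμ hsum hU hU' hon).trans ?_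
  have hrate : 2 * invRate D L = (D ^ L - 1) / (D - 1) * 2 ^ (L + 1) := by
    unfold invRate
    rw [geom_sum_eq hD.ne', pow_succ]
    ring
  rw [hrate]
  have hprod := prod_one_add_nodeWt_le hn2 hLn (by linarith : 1 < c) h hY
  have heta := two_pow_card_mul_le hn2 hlog hcard
  have hδn := hN₁ n ((le_max_left _ _).trans hN)
  have hpre : 0 ≤ (D ^ L - 1) / (D - 1) * 2 ^ (L + 1) :=
    mul_nonneg (div_nonneg (by linarith [one_le_pow₀ hD.le (n := L)]) (by linarith))
      (by positivity)
  refine mul_le_mul_of_nonneg_left (le_trans ?_ hδn) hpre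
  gcongr

end BayesCART
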